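/- Key iterative lemma in Lipschitz-in-space domains (Lemma 2.5): Let K>0. There exist constants M>0, δ∈(0,1) and a>0 depending only on n, λ, Λ and K such that the following holds for every 0<r≤1. Assume [g]_{C^{1,1/2}} ≤ K, and let w be a solution of w_t = Lw in 𝒞_r^− (possibly changing sign) whose negative part w⁻=max(−w,0) vanishes continuously on Γ. If w ≥ M on 𝒜_r and w ≥ −1 on 𝒞_r^−, then w ≥ M·a on 𝒜_{r/2} and w ≥ −a on 𝒞_{r/2}^−. -/

import Mathlib

noncomputable section
open scoped BigOperators
open Classical

abbrev Spc (m : ℕ) := EuclideanSpace ℝ (Fin (m + 1))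
abbrev Spc' (m : ℕ) := EuclideanSpace ℝ (Fin m)

/-- The horizontal coordinates `x' ∈ ℝ^{n-1}` of a point `x ∈ ℝⁿ`. -/
def xprime {m : ℕ} (x : Spc m) : Spc' m :=
  (WithLp.equiv 2 _).symm fun i => x i.castSucc

/-- The last (vertical) coordinate `x_n` of a point `x ∈ ℝⁿ`. -/
def xlast {m : ℕ} (x : Spc m) : ℝ := x (Fin.last m)

/-- Build a point of `ℝⁿ` from `x' ∈ ℝ^{n-1}` and the vertical coordinate. -/
def mkPt {m : ℕ} (x' : Spc' m) (xn : ℝ) : Spc m :=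
  (WithLp.equiv 2 _).symm fun i => if h : i = Fin.last m then xn else x' (i.castPred h)

/-- The `i`-th standard basis vector. -/
def eVec (m : ℕ) (i : Fin (m + 1)) : Spc m := EuclideanSpace.single i 1

/-- The entry `∂²u/∂xᵢ∂xⱼ` of the spatial Hessian of `u(x,t)` at `p = (x,t)`. -/
def sHess {m : ℕ} (u : Spc m × ℝ → ℝ) (p : Spc m × ℝ) (i j : Fin (m + 1)) : ℝ :=
  fderiv ℝ (fun y => fderiv ℝ (fun z => u (z, p.2)) y (eVec m j)) p.1 (eVec m i)

/-- The operator `Lu = tr(A(x) D²ₓu)` at the point `p = (x,t)`. -/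
def Lop {m : ℕ} (A : Spc m → Matrix (Fin (m + 1)) (Fin (m + 1)) ℝ)
    (u : Spc m × ℝ → ℝ) (p : Spc m × ℝ) : ℝ :=
  ∑ i, ∑ j, A p.1 i j * sHess u p j i

/-- Uniform ellipticity with symmetric coefficients: `λ|ξ|² ≤ ξ·A(x)ξ ≤ Λ|ξ|²`. -/
def IsElliptic {m : ℕ} (lam Lam : ℝ)
    (A : Spc m → Matrix (Fin (m + 1)) (Fin (m + 1)) ℝ) : Prop :=
  (∀ x, (A x).IsSymm) ∧
  ∀ (x ξ : Spc m),
    lam * ‖ξ‖ ^ 2 ≤ ∑ i, ∑ j, ξ i * A x i j * ξ j ∧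
      ∑ i, ∑ j, ξ i * A x i j * ξ j ≤ Lam * ‖ξ‖ ^ 2

/-- `u` is (pointwise) a solution of `u_t = Lu` on `Ω`: twice continuously
differentiable in `x`, differentiable in `t`, with `∂ₜu = tr(A(x)D²ₓu)`. -/
def SolvesL {m : ℕ} (A : Spc m → Matrix (Fin (m + 1)) (Fin (m + 1)) ℝ)
    (u : Spc m × ℝ → ℝ) (Ω : Set (Spc m × ℝ)) : Prop :=
  ∀ p ∈ Ω, ContDiffAt ℝ 2 (fun y => u (y, p.2)) p.1 ∧
    HasDerivAt (fun s => u (p.1, s)) (Lop A u p) p.2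

/-- `u` is a pointwise subsolution: `u_t ≤ Lu` on `Ω`. -/
def SubSolvesL {m : ℕ} (A : Spc m → Matrix (Fin (m + 1)) (Fin (m + 1)) ℝ)
    (u : Spc m × ℝ → ℝ) (Ω : Set (Spc m × ℝ)) : Prop :=
  ∀ p ∈ Ω, ContDiffAt ℝ 2 (fun y => u (y, p.2)) p.1 ∧
    DifferentiableAt ℝ (fun s => u (p.1, s)) p.2 ∧
    deriv (fun s => u (p.1, s)) p.2 ≤ Lop A u p

/-- `u` solves the heat equation `∂ₜu = Δu` on `Ω`. -/
def SolvesHeat {m : ℕ} (u : Spc m × ℝ → ℝ) (Ω : Set (Spc m × ℝ)) : Prop :=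
  ∀ p ∈ Ω, ContDiffAt ℝ 2 (fun y => u (y, p.2)) p.1 ∧
    HasDerivAt (fun s => u (p.1, s)) (∑ i, sHess u p i i) p.2

/-- The graph `Γ = {x_n = g(x',t)}`. -/
def graphSet {m : ℕ} (g : Spc' m → ℝ → ℝ) : Set (Spc m × ℝ) :=
  {p | xlast p.1 = g (xprime p.1) p.2}

/-- The cylinder `𝒞_r` of size `r` on top of the graph of `g`. -/
def Cyl {m : ℕ} (g : Spc' m → ℝ → ℝ) (r : ℝ) : Set (Spc m × ℝ) :=
  {p | ‖xprime p.1‖ < r ∧ -r ^ 2 < p.2 ∧ p.2 < r ^ 2 ∧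
    g (xprime p.1) p.2 < xlast p.1 ∧ xlast p.1 < g (xprime p.1) p.2 + r}

/-- The point `Ē = ((0', g(0',1/2) + 1/2), 1/2)`. -/
def Ebar {m : ℕ} (g : Spc' m → ℝ → ℝ) : Spc m × ℝ := (mkPt 0 (g 0 (1 / 2) + 1 / 2), 1 / 2)

/-- The point `E̲ = ((0', g(0',−1/2) + 1/2), −1/2)`. -/
def Eund {m : ℕ} (g : Spc' m → ℝ → ℝ) : Spc m × ℝ := (mkPt 0 (g 0 (-(1 / 2)) + 1 / 2), -(1 / 2))

/-- `u` vanishes continuously on `Γ`: `u(Q) → 0` as `Q → P` within `Ω`,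
for every `P ∈ Γ` in the closure of `Ω`. -/
def VanishesOn {m : ℕ} (u : Spc m × ℝ → ℝ) (Ω Γ : Set (Spc m × ℝ)) : Prop :=
  ∀ P ∈ Γ ∩ closure Ω, Filter.Tendsto u (nhdsWithin P Ω) (nhds 0)

/-- `[g]_{C^{α,β}} ≤ K`. -/
def HolderSemi {m : ℕ} (α β K : ℝ) (g : Spc' m → ℝ → ℝ) : Prop :=
  ∀ x' y' t s, |g x' t - g y' s| ≤ K * (‖x' - y'‖ ^ α + |t - s| ^ β)

/-- The backward-in-time cylinder `𝒞_r^−` (Lipschitz setting, parabolic scaling). -/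
def CylB {m : ℕ} (g : Spc' m → ℝ → ℝ) (r : ℝ) : Set (Spc m × ℝ) :=
  {p | (∀ i : Fin m, -r < xprime p.1 i ∧ xprime p.1 i < r) ∧ -r ^ 2 < p.2 ∧ p.2 ≤ 0 ∧
    g (xprime p.1) p.2 < xlast p.1 ∧ xlast p.1 < g (xprime p.1) p.2 + r}

/-- The set `𝒜_r` of points of `𝒞_r^−` at height at least `δr` above `Γ`. -/
def ASet {m : ℕ} (g : Spc' m → ℝ → ℝ) (δ r : ℝ) : Set (Spc m × ℝ) :=
  {p ∈ CylB g r | g (xprime p.1) p.2 + δ * r ≤ xlast p.1}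

/-- The backward-in-time cylinder `𝒞_r^−` (Hölder setting, time interval `(−r,0]`). -/
def CylBH {m : ℕ} (g : Spc' m → ℝ → ℝ) (r : ℝ) : Set (Spc m × ℝ) :=
  {p | (∀ i : Fin m, -r < xprime p.1 i ∧ xprime p.1 i < r) ∧ -r < p.2 ∧ p.2 ≤ 0 ∧
    g (xprime p.1) p.2 < xlast p.1 ∧ xlast p.1 < g (xprime p.1) p.2 + r}

/-- The set `𝒜_r` of points of the Hölder cylinder `𝒞_r^−` at height at least `r^β` above `Γ`. -/
def ASetH {m : ℕ} (g : Spc' m → ℝ → ℝ) (β r : ℝ) : Set (Spc m × ℝ) :=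
  {p ∈ CylBH g r | g (xprime p.1) p.2 + r ^ β ≤ xlast p.1}

/-- The height `h_Γ(x,t) = x_n − g(x',t)` above the graph. -/
def hGamma {m : ℕ} (g : Spc' m → ℝ → ℝ) (p : Spc m × ℝ) : ℝ :=
  xlast p.1 - g (xprime p.1) p.2

open Filter Topology Set

section Hessian

variable {m : ℕ}

/-- `H` is the second derivative of `φ` at `x`. -/
def HasHess (φ : Spc m → ℝ) (x : Spc m) (H : Spc m →L[ℝ] Spc m →L[ℝ] ℝ) : Prop :=
  ∃ G : Spc m → (Spc m →L[ℝ] ℝ), (∀ᶠ y in 𝓝 x, HasFDerivAt φ (G y) y) ∧ HasFDerivAt G H x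

/-- `tr(A(x) H)`. -/
def trL (A : Spc m → Matrix (Fin (m + 1)) (Fin (m + 1)) ℝ) (x : Spc m)
    (H : Spc m →L[ℝ] Spc m →L[ℝ] ℝ) : ℝ :=
  ∑ i, ∑ j, A x i j * H (eVec m j) (eVec m i)

lemma trL_add (A : Spc m → Matrix (Fin (m + 1)) (Fin (m + 1)) ℝ) (x : Spc m)
    (H H' : Spc m →L[ℝ] Spc m →L[ℝ] ℝ) : trL A x (H + H') = trL A x H + trL A x H' := by
  simp [trL, mul_add, Finset.sum_add_distrib]

lemma trL_smul (A : Spc m → Matrix (Fin (m + 1)) (Fin (m + 1)) ℝ) (x : Spc m) (c : ℝ)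
    (H : Spc m →L[ℝ] Spc m →L[ℝ] ℝ) : trL A x (c • H) = c * trL A x H := by
  simp only [trL, Finset.mul_sum, FunLike.coe_smul, Pi.smul_apply, smul_eq_mul]
  exact Finset.sum_congr rfl fun i _ => Finset.sum_congr rfl fun j _ => by ring

lemma HasHess.add {φ ψ : Spc m → ℝ} {x : Spc m} {H H' : Spc m →L[ℝ] Spc m →L[ℝ] ℝ}
    (h : HasHess φ x H) (h' : HasHess ψ x H') : HasHess (fun y => φ y + ψ y) x (H + H') := by
  obtain ⟨G, hG, hH⟩ := h
  obtain ⟨G', hG', hH'⟩ := h'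
  refine ⟨fun y => G y + G' y, ?_, hH.add hH'⟩
  filter_upwards [hG, hG'] with y h1 h2 using h1.add h2

lemma HasHess.const_mul {φ : Spc m → ℝ} {x : Spc m} {H : Spc m →L[ℝ] Spc m →L[ℝ] ℝ}
    (h : HasHess φ x H) (c : ℝ) : HasHess (fun y => c * φ y) x (c • H) := by
  obtain ⟨G, hG, hH⟩ := h
  refine ⟨fun y => c • G y, ?_, hH.const_smul c⟩
  filter_upwards [hG] with y h1 using h1.const_mul c

lemma HasHess.add_const {φ : Spc m → ℝ} {x : Spc m} {H : Spc m →L[ℝ] Spc m →L[ℝ] ℝ}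
    (h : HasHess φ x H) (c : ℝ) : HasHess (fun y => φ y + c) x H := by
  obtain ⟨G, hG, hH⟩ := h
  refine ⟨G, ?_, hH⟩
  filter_upwards [hG] with y h1 using h1.add_const c

lemma SolvesL.hasHess {A : Spc m → Matrix (Fin (m + 1)) (Fin (m + 1)) ℝ} {u : Spc m × ℝ → ℝ}
    {Ω : Set (Spc m × ℝ)} (h : SolvesL A u Ω) {p : Spc m × ℝ} (hp : p ∈ Ω) :
    ∃ H, HasHess (fun y => u (y, p.2)) p.1 H ∧
      HasDerivAt (fun s => u (p.1, s)) (trL A p.1 H) p.2 := by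
  obtain ⟨h1, h2⟩ := h p hp
  have hd : DifferentiableAt ℝ (fderiv ℝ (fun y => u (y, p.2))) p.1 :=
    (h1.fderiv_right (m := 1) (by norm_num)).differentiableAt (by norm_num)
  refine ⟨fderiv ℝ (fderiv ℝ (fun y => u (y, p.2))) p.1, ⟨fderiv ℝ (fun y => u (y, p.2)), ?_,
    hd.hasFDerivAt⟩, ?_⟩
  · filter_upwards [h1.eventually (by simp)] with y hy
    exact (hy.differentiableAt (by norm_num)).hasFDerivAt
  · convert h2 using 1
    refine Finset.sum_congr rfl fun i _ => Finset.sum_congr rfl fun j _ => ?_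
    congr 1
    rw [sHess, fderiv_clm_apply hd (by fun_prop)]
    simp

/-- Necessary second order condition at a local minimum. -/
lemma HasHess.nonneg_of_isLocalMin {φ : Spc m → ℝ} {x : Spc m}
    {H : Spc m →L[ℝ] Spc m →L[ℝ] ℝ} (h : HasHess φ x H) (hmin : IsLocalMin φ x) (v : Spc m) :
    0 ≤ H v v := by
  obtain ⟨G, hG, hH⟩ := h
  by_contra! hneg
  let γ : ℝ → Spc m := fun s => x + s • v
  have hγd : ∀ s, HasDerivAt γ v s := fun s => by
    simpa only [γ, one_smul, id] using ((hasDerivAt_id s).smul_const v).const_add x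
  have hγ0 : γ 0 = x := by simp [γ]
  have hγ : Tendsto γ (𝓝 0) (𝓝 x) := by
    simpa [hγ0] using (hγd 0).continuousAt.tendsto
  have hd : ∀ᶠ s in 𝓝 0, HasDerivAt (fun s => φ (γ s)) (G (γ s) v) s := by
    filter_upwards [hγ.eventually hG] with s hs
    exact hs.comp_hasDerivAt s (hγd s)
  have hd' : deriv (fun s => φ (γ s)) =ᶠ[𝓝 0] fun s => G (γ s) v := by
    filter_upwards [hd] with s hs using hs.deriv
  have h2 : HasDerivAt (fun s => G (γ s) v) (H v v) 0 := by
    have : HasFDerivAt G H (γ 0) := by rwa [hγ0]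
    have := (this.comp_hasDerivAt (0 : ℝ) (hγd 0)).clm_apply (hasDerivAt_const (0 : ℝ) v)
    simpa using this
  have hmin' : IsLocalMin (fun s => φ (γ s)) 0 := by
    have : ∀ᶠ s in 𝓝 (0 : ℝ), φ x ≤ φ (γ s) := hγ.eventually hmin
    simpa [IsLocalMin, IsMinFilter, hγ0] using this
  have hdd : deriv (deriv fun s => φ (γ s)) 0 = H v v := by
    rw [hd'.deriv_eq, h2.deriv]
  have hmax := isLocalMax_of_deriv_deriv_neg (by rw [hdd]; exact hneg)
    hmin'.deriv_eq_zero hd.self_of_nhds.continuousAt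
  have hconst : (fun s => φ (γ s)) =ᶠ[𝓝 0] fun _ => φ (γ 0) := by
    filter_upwards [hmin', hmax] with s h1 h2 using le_antisymm h2 h1
  have := hconst.deriv.deriv_eq
  rw [hdd] at this
  simp at this
  linarith

lemma IsElliptic.posSemidef {lam Lam : ℝ} {A : Spc m → Matrix (Fin (m + 1)) (Fin (m + 1)) ℝ}
    (hA : IsElliptic lam Lam A) (hlam : 0 < lam) (x : Spc m) : (A x).PosSemidef := by
  refine Matrix.PosSemidef.of_dotProduct_mulVec_nonneg ?_ fun ξ => ?_
  · have := hA.1 x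
    rwa [Matrix.IsHermitian, Matrix.conjTranspose_eq_transpose_of_trivial]
  · have := (hA.2 x (WithLp.toLp 2 ξ)).1
    simp only [dotProduct, Matrix.mulVec, Finset.mul_sum]
    refine le_trans (by positivity) (this.trans (le_of_eq ?_))
    simp [mul_assoc]

open scoped MatrixOrder in
lemma trL_nonneg {lam Lam : ℝ} {A : Spc m → Matrix (Fin (m + 1)) (Fin (m + 1)) ℝ}
    (hA : IsElliptic lam Lam A) (hlam : 0 < lam) (x : Spc m) {H : Spc m →L[ℝ] Spc m →L[ℝ] ℝ}
    (hH : ∀ v, 0 ≤ H v v) : 0 ≤ trL A x H := by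
  obtain ⟨B, hB⟩ := CStarAlgebra.nonneg_iff_eq_star_mul_self.mp (hA.posSemidef hlam x).nonneg
  have key : trL A x H = ∑ k, H (∑ j, B k j • eVec m j) (∑ i, B k i • eVec m i) := by
    simp only [trL, hB, Matrix.star_eq_conjTranspose, Matrix.mul_apply, Matrix.conjTranspose_apply,
      star_trivial, map_sum, map_smul, sum_apply, FunLike.coe_smul, Pi.smul_apply, smul_eq_mul,
      Finset.sum_mul, Finset.mul_sum]
    rw [Finset.sum_congr rfl fun i _ => Finset.sum_comm, Finset.sum_comm]
    refine Finset.sum_congr rfl fun k _ => ?_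
    refine Finset.sum_congr rfl fun i _ => Finset.sum_congr rfl fun j _ => by ring
  rw [key]
  exact Finset.sum_nonneg fun k _ => hH _

end Hessian

section MinimumPrinciple

variable {m : ℕ}

/-- Lower semicontinuity of `f` at `p` along non-earlier times. -/
def ForwardLSC (f : Spc m × ℝ → ℝ) (p : Spc m × ℝ) : Prop :=
  ∀ η > 0, ∀ᶠ q in 𝓝 p, p.2 ≤ q.2 → f p - η < f q

/-- `f` is a pointwise strict supersolution of `f_t = Lf` at `p`. -/
def StrictSuper (A : Spc m → Matrix (Fin (m + 1)) (Fin (m + 1)) ℝ) (f : Spc m × ℝ → ℝ)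
    (p : Spc m × ℝ) : Prop :=
  ∃ c H, HasDerivAt (fun s => f (p.1, s)) c p.2 ∧ HasHess (fun y => f (y, p.2)) p.1 H ∧
    trL A p.1 H < c

lemma ForwardLSC.add_continuousAt {f g : Spc m × ℝ → ℝ} {p : Spc m × ℝ} (hf : ForwardLSC f p)
    (hg : ContinuousAt g p) : ForwardLSC (fun q => f q + g q) p := by
  intro η hη
  filter_upwards [hf (η / 2) (half_pos hη),
    hg.eventually (lt_mem_nhds (sub_lt_self (g p) (half_pos hη)))] with q h1 h2 hq
  linarith [h1 hq]

lemma tendsto_shift (p : Spc m × ℝ) (h : ℝ) :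
    Tendsto (fun q : Spc m × ℝ => (q.1, q.2 - h)) (𝓝 p) (𝓝 (p.1, p.2 - h)) :=
  Continuous.tendsto (by fun_prop) p

lemma StrictSuper.add_shift {A : Spc m → Matrix (Fin (m + 1)) (Fin (m + 1)) ℝ}
    {f : Spc m × ℝ → ℝ} {p : Spc m × ℝ} {h : ℝ} (hf : StrictSuper A f p)
    (hf' : StrictSuper A f (p.1, p.2 - h)) (k : ℝ) :
    StrictSuper A (fun q => f q + f (q.1, q.2 - h) + k) p := by
  obtain ⟨c, H, h1, h2, h3⟩ := hf
  obtain ⟨c', H', h1', h2', h3'⟩ := hf'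
  refine ⟨c + c', H + H', (h1.add ?_).add_const k, (h2.add h2').add_const k, ?_⟩
  · have := HasDerivAt.comp p.2 h1' ((hasDerivAt_id p.2).sub_const h)
    simpa [Function.comp_def] using this
  · rw [trL_add]; linarith

/-- A strict supersolution has no minimum relative to the present slice and the past. -/
lemma StrictSuper.not_isMin {lam Lam : ℝ} {A : Spc m → Matrix (Fin (m + 1)) (Fin (m + 1)) ℝ}
    (hA : IsElliptic lam Lam A) (hlam : 0 < lam) {f : Spc m × ℝ → ℝ} {p : Spc m × ℝ}
    (hf : StrictSuper A f p) (hx : ∀ᶠ y in 𝓝 p.1, f p ≤ f (y, p.2))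
    (ht : ∀ᶠ s in 𝓝[<] p.2, f p ≤ f (p.1, s)) : False := by
  obtain ⟨c, H, h1, h2, h3⟩ := hf
  have hH : 0 ≤ trL A p.1 H := trL_nonneg hA hlam _ (h2.nonneg_of_isLocalMin hx)
  have hc : c ≤ 0 := by
    have := (hasDerivWithinAt_iff_tendsto_slope' (s := Iio p.2) (by simp)).mp
      (h1.hasDerivWithinAt (s := Iio p.2))
    refine le_of_tendsto this ?_
    filter_upwards [ht, self_mem_nhdsWithin] with s hs hs'
    rw [slope_def_field]
    exact div_nonpos_of_nonneg_of_nonpos (sub_nonneg.mpr hs) (sub_nonpos.mpr (le_of_lt hs'))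
  linarith

/-- Parabolic minimum principle for strict supersolutions that are only separately regular and
lower semicontinuous forward in time. -/
lemma minimum_principle {lam Lam : ℝ} {A : Spc m → Matrix (Fin (m + 1)) (Fin (m + 1)) ℝ}
    (hA : IsElliptic lam Lam A) (hlam : 0 < lam) {f : Spc m × ℝ → ℝ} {D : Set (Spc m × ℝ)}
    {T : ℝ} (hD : Bornology.IsBounded D) (hDT : ∀ p ∈ D, p.2 < T)
    (hcl : ∀ p ∈ closure D, p.2 < T →
      (∀ᶠ q in 𝓝 p, q ∈ D → p.2 ≤ q.2 → 0 ≤ f q) ∨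
      (p ∈ D ∧ (∀ᶠ y in 𝓝 p.1, (y, p.2) ∈ D) ∧ (∀ᶠ s in 𝓝[<] p.2, (p.1, s) ∈ D) ∧
        ForwardLSC f p ∧ StrictSuper A f p)) :
    ∀ p ∈ D, 0 ≤ f p := by
  by_contra! hne
  obtain ⟨p0, hp0, hfp0⟩ := hne
  let Bad : Set (Spc m × ℝ) := {p ∈ D | f p < 0}
  have hBne : (Prod.snd '' Bad).Nonempty := ⟨p0.2, p0, ⟨hp0, hfp0⟩, rfl⟩
  have hBb : BddBelow (Prod.snd '' Bad) :=
    ((hD.subset (sep_subset D _)).image_snd).bddBelow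
  obtain ⟨u, -, hu, huB⟩ := exists_seq_tendsto_sInf hBne hBb
  set t := sInf (Prod.snd '' Bad) with ht
  have hle : ∀ p ∈ Bad, t ≤ p.2 := fun p hp => csInf_le hBb ⟨p, hp, rfl⟩
  choose q hqB hqu using huB
  obtain ⟨p, hp, φ, hφ, hlim⟩ := tendsto_subseq_of_bounded hD (fun n => (hqB n).1)
  have hpt : p.2 = t := by
    have h1 : Tendsto (fun n => (q (φ n)).2) atTop (𝓝 p.2) :=
      (continuous_snd.tendsto p).comp hlim
    refine tendsto_nhds_unique h1 ?_
    simp only [hqu]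
    exact hu.comp hφ.tendsto_atTop
  have hpT : p.2 < T := by
    rw [hpt]; exact (hle p0 ⟨hp0, hfp0⟩).trans_lt (hDT p0 hp0)
  have hnotBad : ∀ y, (y, t) ∉ Bad := by
    intro y hy
    rcases hcl (y, t) (subset_closure hy.1) (hDT _ hy.1) with h | ⟨-, -, h1, -, c, H, h2, -⟩
    · exact absurd (h.self_of_nhds hy.1 le_rfl) (not_le.mpr hy.2)
    · have h3 : ∀ᶠ s in 𝓝[<] t, f (y, s) < 0 :=
        (h2.continuousAt.eventually (gt_mem_nhds hy.2)).filter_mono nhdsWithin_le_nhds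
      obtain ⟨s, ⟨hs1, hs2⟩, hs3⟩ := ((h1.and h3).and self_mem_nhdsWithin).exists
      exact absurd (hle (y, s) ⟨hs1, hs2⟩) (not_le.mpr hs3)
  rcases hcl p hp hpT with h | ⟨hpD, h1, h2, h3, h4⟩
  · obtain ⟨n, hn⟩ := (hlim.eventually h).exists
    exact absurd (hn (hqB _).1 (hpt ▸ hle _ (hqB _))) (not_le.mpr (hqB _).2)
  · have hfp : f p ≤ 0 := by
      refine le_of_forall_pos_le_add fun η hη => ?_
      obtain ⟨n, hn⟩ := (hlim.eventually (h3 η hη)).exists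
      have := hn (hpt ▸ hle _ (hqB _))
      have h5 : f ((q ∘ φ) n) < 0 := (hqB (φ n)).2
      linarith
    refine h4.not_isMin hA hlam ?_ ?_
    · filter_upwards [h1] with y hy
      refine hfp.trans (not_lt.mp fun h => hnotBad y ?_)
      rw [← hpt]; exact ⟨hy, h⟩
    · filter_upwards [h2, self_mem_nhdsWithin] with s hs hs'
      refine hfp.trans (not_lt.mp fun h => ?_)
      exact absurd (hle (p.1, s) ⟨hs, h⟩) (not_le.mpr (hpt ▸ hs'))

/-- Minimum principle on a cylinder whose bottom may contain singular points `S × {a}`, as long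
as the function is nonnegative above them. The coefficients being independent of time,
a negative infimum can be doubled by adding a translate in time. -/
lemma minimum_principle_singular_bottom {lam Lam : ℝ}
    {A : Spc m → Matrix (Fin (m + 1)) (Fin (m + 1)) ℝ}
    (hA : IsElliptic lam Lam A) (hlam : 0 < lam) {v : Spc m × ℝ → ℝ} {x₀ : Spc m} {ρ a T C : ℝ}
    {S : Set (Spc m)}
    (hC : ∀ x, ‖x - x₀‖ ≤ ρ → ∀ t, a ≤ t → t < T → -C ≤ v (x, t))
    (hinit : ∀ x, ‖x - x₀‖ ≤ ρ → 0 ≤ v (x, a))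
    (hS : ∀ x ∈ S, ‖x - x₀‖ ≤ ρ → ∀ t, a ≤ t → t < T → 0 ≤ v (x, t))
    (hlat : ∀ x, ‖x - x₀‖ = ρ → ∀ t, a ≤ t → t < T → 0 ≤ v (x, t))
    (hlsc : ∀ x, ‖x - x₀‖ ≤ ρ → ∀ t, a < t → t < T → ForwardLSC v (x, t))
    (hlsc_a : ∀ x, ‖x - x₀‖ ≤ ρ → x ∉ S → ForwardLSC v (x, a))
    (hsup : ∀ x, ‖x - x₀‖ < ρ → ∀ t, a < t → t < T → StrictSuper A v (x, t)) :
    ∀ x, ‖x - x₀‖ ≤ ρ → ∀ t, a ≤ t → t < T → 0 ≤ v (x, t) := by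
  by_contra! hneg
  obtain ⟨x', hx', t', ht', htT', hv'⟩ := hneg
  let R : Set ℝ := v '' {q | ‖q.1 - x₀‖ ≤ ρ ∧ a ≤ q.2 ∧ q.2 < T}
  have hRb : BddBelow R := ⟨-C, by
    rintro _ ⟨q, ⟨h1, h2, h3⟩, rfl⟩
    exact hC q.1 h1 q.2 h2 h3⟩
  have hRne : R.Nonempty := ⟨_, (x', t'), ⟨hx', ht', htT'⟩, rfl⟩
  obtain ⟨B, hB⟩ : ∃ B, B = -sInf R := ⟨_, rfl⟩
  have hlow : ∀ x, ‖x - x₀‖ ≤ ρ → ∀ t, a ≤ t → t < T → -B ≤ v (x, t) := by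
    intro x hx t h1 h2
    rw [hB, neg_neg]
    exact csInf_le hRb ⟨(x, t), ⟨hx, h1, h2⟩, rfl⟩
  have hBpos : 0 < B := by linarith [hlow x' hx' t' ht' htT']
  obtain ⟨_, ⟨⟨x₁, t₁⟩, ⟨hx₁, ht₁, htT₁⟩, rfl⟩, hv₁⟩ :=
    exists_lt_of_csInf_lt hRne (show sInf R < -(4 / 5 * B) by linarith)
  dsimp only at hx₁ ht₁ htT₁
  have ht₁' : a < t₁ := by
    rcases ht₁.eq_or_lt with rfl | h
    · linarith [hinit x₁ hx₁]
    · exact h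
  have hx₁' : ‖x₁ - x₀‖ < ρ := by
    rcases hx₁.eq_or_lt with h | h
    · linarith [hlat x₁ h t₁ ht₁ htT₁]
    · exact h
  obtain ⟨h, hh, hha, hvh⟩ : ∃ h > 0, a < t₁ - h ∧ v (x₁, t₁ - h) < -(4 / 5 * B) := by
    obtain ⟨c, H, hd, -⟩ := hsup x₁ hx₁' t₁ ht₁' htT₁
    have h1 : ∀ᶠ s in 𝓝 t₁, v (x₁, s) < -(4 / 5 * B) ∧ a < s :=
      (hd.continuousAt.eventually (gt_mem_nhds hv₁)).and (lt_mem_nhds ht₁')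
    have h2 : Tendsto (fun h : ℝ => t₁ - h) (𝓝[>] 0) (𝓝 t₁) := by
      have : Tendsto (fun h : ℝ => t₁ - h) (𝓝 0) (𝓝 (t₁ - 0)) :=
        Continuous.tendsto (by fun_prop) 0
      rw [sub_zero] at this
      exact this.mono_left nhdsWithin_le_nhds
    obtain ⟨h, ⟨h3, h4⟩, h5⟩ := ((h2.eventually h1).and self_mem_nhdsWithin).exists
    exact ⟨h, h5, h4, h3⟩
  have key := minimum_principle hA hlam (T := T)
    (f := fun q => v q + v (q.1, q.2 - h) + 3 / 2 * B)
    (D := {q | ‖q.1 - x₀‖ < ρ ∧ a + h < q.2 ∧ q.2 < T}) ?_ (fun p hp => hp.2.2) ?_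
    (x₁, t₁) ⟨hx₁', by dsimp only; linarith, htT₁⟩
  · dsimp only at key
    linarith
  · refine ((Metric.isBounded_ball (x := x₀) (r := ρ)).prod
      (Metric.isBounded_Ioo (a + h) T)).subset ?_
    rintro q ⟨h1, h2, h3⟩
    exact ⟨by simpa [dist_eq_norm] using h1, h2, h3⟩
  rintro ⟨x, t⟩ hp hT
  dsimp only at hT
  have hcl : (x, t) ∈ {q : Spc m × ℝ | ‖q.1 - x₀‖ ≤ ρ ∧ a + h ≤ q.2} := by
    have hc : IsClosed {q : Spc m × ℝ | ‖q.1 - x₀‖ ≤ ρ ∧ a + h ≤ q.2} :=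
      by
      rw [ofPred_and]
      exact (isClosed_le (by fun_prop) continuous_const).inter
        (isClosed_le continuous_const continuous_snd)
    have hsub : {q : Spc m × ℝ | ‖q.1 - x₀‖ < ρ ∧ a + h < q.2 ∧ q.2 < T} ⊆
        {q | ‖q.1 - x₀‖ ≤ ρ ∧ a + h ≤ q.2} := fun q hq => ⟨le_of_lt hq.1, le_of_lt hq.2.1⟩
    have := closure_minimal hsub hc
    exact this hp
  obtain ⟨hx, ht⟩ := hcl
  have hl1 : ForwardLSC v (x, t) := hlsc x hx t (by linarith) hT
  have hshift : ForwardLSC v (x, t - h) → ∀ η > 0, ∀ᶠ q in 𝓝 (x, t), t ≤ q.2 →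
      v (x, t - h) - η < v (q.1, q.2 - h) := by
    intro hl η hη
    filter_upwards [(tendsto_shift (x, t) h).eventually (hl η hη)] with q hq hqt
    exact hq (by linarith)
  have hsafe : ForwardLSC v (x, t - h) → -(5 / 4 * B) ≤ v (x, t) + v (x, t - h) →
      ∀ᶠ q in 𝓝 (x, t), t ≤ q.2 → 0 ≤ v q + v (q.1, q.2 - h) + 3 / 2 * B := by
    intro hl hv
    filter_upwards [hl1 (B / 8) (by positivity), hshift hl (B / 8) (by positivity)]
      with q h1 h2 hq
    linarith [h1 hq, h2 hq]
  rcases ht.eq_or_lt with rfl | ht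
  · left
    by_cases hxS : x ∈ S
    · filter_upwards [hl1 (B / 8) (by positivity)] with q h1 hq hqt
      have h2 := hS x hxS hx (a + h) (by linarith) hT
      have h3 := hlow q.1 hq.1.le (q.2 - h) (by linarith [hq.2.1]) (by linarith [hq.2.2])
      linarith [h1 hqt]
    · have h0 : a + h - h = a := by ring
      filter_upwards [hsafe (by rw [h0]; exact hlsc_a x hx hxS) (by
        rw [h0]; linarith [hinit x hx, hlow x hx (a + h) (by linarith) hT])] with q h1 _ hqt
      exact h1 hqt
  · have hl2 : ForwardLSC v (x, t - h) := hlsc x hx (t - h) (by linarith) (by linarith)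
    rcases hx.eq_or_lt with hx' | hx'
    · left
      filter_upwards [hsafe hl2 (by
        linarith [hlat x hx' t (by linarith) hT,
          hlat x hx' (t - h) (by linarith) (by linarith)])] with q h1 _ hqt
      exact h1 hqt
    · right
      refine ⟨⟨hx', ht, hT⟩, ?_, ?_, ?_, ?_⟩
      · have : ∀ᶠ y in 𝓝 x, ‖y - x₀‖ < ρ :=
          (Continuous.tendsto (by fun_prop : Continuous fun y => ‖y - x₀‖) x).eventually
            (gt_mem_nhds hx')
        filter_upwards [this] with y hy using ⟨hy, ht, hT⟩
      · filter_upwards [(lt_mem_nhds ht).filter_mono nhdsWithin_le_nhds, self_mem_nhdsWithin]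
          with s h1 h2 using ⟨hx', h1, lt_trans h2 hT⟩
      · intro η hη
        filter_upwards [hl1 (η / 2) (by positivity), hshift hl2 (η / 2) (by positivity)]
          with q h1 h2 hq
        linarith [h1 hq, h2 hq]
      · exact (hsup x hx' t (by linarith) hT).add_shift
          (hsup x hx' (t - h) (by linarith) (by linarith)) _

end MinimumPrinciple

section Quadratic

variable {m : ℕ}

/-- The weighted quadratic `∑ dᵢ (xᵢ - yᵢ)²`. -/
def quad (d : Fin (m + 1) → ℝ) (y x : Spc m) : ℝ := ∑ i, d i * (x i - y i) ^ 2

/-- The second derivative of `quad d y`. -/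
def quadHess (d : Fin (m + 1) → ℝ) : Spc m →L[ℝ] Spc m →L[ℝ] ℝ :=
  ∑ i, (2 * d i) • (EuclideanSpace.proj i : Spc m →L[ℝ] ℝ).smulRight
    (EuclideanSpace.proj i : Spc m →L[ℝ] ℝ)

lemma quadHess_apply (d : Fin (m + 1) → ℝ) (u v : Spc m) :
    quadHess d u v = ∑ i, 2 * d i * u i * v i := by
  simp [quadHess, sum_apply, mul_assoc]

lemma quadHess_eVec (d : Fin (m + 1) → ℝ) (u : Spc m) (i : Fin (m + 1)) :
    quadHess d u (eVec m i) = 2 * d i * u i := by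
  rw [quadHess_apply, Finset.sum_eq_single i]
  · simp [eVec]
  · intro j _ hj
    simp [eVec, hj]
  · simp

lemma quad_continuous (d : Fin (m + 1) → ℝ) (y : Spc m) : Continuous (quad d y) := by
  unfold quad
  fun_prop

lemma quad_one (y x : Spc m) : quad (fun _ => 1) y x = ‖x - y‖ ^ 2 := by
  simp [quad, EuclideanSpace.norm_sq_eq]

lemma quad_hasFDerivAt (d : Fin (m + 1) → ℝ) (y x : Spc m) :
    HasFDerivAt (quad d y) (quadHess d (x - y)) x := by
  have h : ∀ i, HasFDerivAt (fun x : Spc m => d i * (x i - y i) ^ 2)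
      ((2 * d i * (x i - y i)) • (EuclideanSpace.proj i : Spc m →L[ℝ] ℝ)) x := by
    intro i
    have h1 : HasFDerivAt (fun x : Spc m => x i) (EuclideanSpace.proj i : Spc m →L[ℝ] ℝ) x :=
      (EuclideanSpace.proj i : Spc m →L[ℝ] ℝ).hasFDerivAt
    refine (((h1.sub_const (y i)).pow 2).const_mul (d i)).congr_fderiv ?_
    refine ContinuousLinearMap.ext fun v => ?_
    simp
    ring
  refine (HasFDerivAt.fun_sum (u := Finset.univ) fun i _ => h i).congr_fderiv ?_
  refine ContinuousLinearMap.ext fun v => ?_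
  rw [quadHess_apply]
  simp [sum_apply]

lemma quad_hasHess (d : Fin (m + 1) → ℝ) (y x : Spc m) : HasHess (quad d y) x (quadHess d) := by
  refine ⟨fun x => quadHess d (x - y), Eventually.of_forall (quad_hasFDerivAt d y), ?_⟩
  exact (quadHess d).hasFDerivAt.comp x ((hasFDerivAt_id x).sub_const y)

lemma IsElliptic.diag_le {lam Lam : ℝ} {A : Spc m → Matrix (Fin (m + 1)) (Fin (m + 1)) ℝ}
    (hA : IsElliptic lam Lam A) (x : Spc m) (i : Fin (m + 1)) : A x i i ≤ Lam := by
  have := (hA.2 x (eVec m i)).2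
  simpa [eVec] using this

lemma trL_quadHess (A : Spc m → Matrix (Fin (m + 1)) (Fin (m + 1)) ℝ) (x : Spc m)
    (d : Fin (m + 1) → ℝ) : trL A x (quadHess d) = ∑ i, 2 * d i * A x i i := by
  simp only [trL, quadHess_eVec]
  refine Finset.sum_congr rfl fun i _ => ?_
  rw [Finset.sum_eq_single i]
  · simp [eVec]; ring
  · intro j _ hj
    simp [eVec, Ne.symm hj]
  · simp

lemma trL_quadHess_le {lam Lam b : ℝ} {A : Spc m → Matrix (Fin (m + 1)) (Fin (m + 1)) ℝ}
    (hA : IsElliptic lam Lam A) (hLam : 0 ≤ Lam) (x : Spc m) {d : Fin (m + 1) → ℝ}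
    (hd0 : ∀ i, 0 ≤ d i) (hd : ∀ i, d i ≤ b) :
    trL A x (quadHess d) ≤ 2 * (m + 1) * b * Lam := by
  rw [trL_quadHess]
  calc ∑ i, 2 * d i * A x i i ≤ ∑ _i : Fin (m + 1), 2 * b * Lam := by
        refine Finset.sum_le_sum fun i _ => ?_
        have h1 := mul_le_mul_of_nonneg_left (hA.diag_le x i) (hd0 i)
        have h2 := mul_le_mul_of_nonneg_right (hd i) hLam
        linarith
    _ = _ := by simp; ring

end Quadratic

section ForwardSemicontinuity

variable {m : ℕ}

lemma lower_bound_above_slice {lam Lam : ℝ}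
    {A : Spc m → Matrix (Fin (m + 1)) (Fin (m + 1)) ℝ}
    (hA : IsElliptic lam Lam A) (hlam : 0 < lam) (hlamLam : lam ≤ Lam)
    {w : Spc m × ℝ → ℝ} {Ω : Set (Spc m × ℝ)} (hw : SolvesL A w Ω) {c₀ : ℝ}
    (hlow : ∀ p ∈ Ω, c₀ ≤ w p) {x₀ : Spc m} {ρ a T μ C : ℝ} (hρ : 0 < ρ)
    (hC : 0 < C) (hμC : μ - C ≤ c₀) {S : Set (Spc m)}
    (hΩ : ∀ x, ‖x - x₀‖ ≤ ρ → ∀ t, a ≤ t → t < T → (x, t) ∈ Ω)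
    (hinit : ∀ x, ‖x - x₀‖ ≤ ρ → μ ≤ w (x, a))
    (hS : ∀ x ∈ S, ‖x - x₀‖ ≤ ρ → ∀ t, a ≤ t → t < T → μ ≤ w (x, t))
    (hlsc : ∀ x, ‖x - x₀‖ ≤ ρ → ∀ t, a < t → t < T → ForwardLSC w (x, t))
    (hlsc_a : ∀ x, ‖x - x₀‖ ≤ ρ → x ∉ S → ForwardLSC w (x, a)) :
    ∀ x, ‖x - x₀‖ ≤ ρ → ∀ t, a ≤ t → t < T →
      μ - C / ρ ^ 2 * (‖x - x₀‖ ^ 2 + (2 * (m + 1) * Lam + 1) * (t - a)) ≤ w (x, t) := by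
  have hLam : 0 < Lam := hlam.trans_le hlamLam
  have hCρ : 0 < C / ρ ^ 2 := by positivity
  set β : Spc m × ℝ → ℝ := fun q => C / ρ ^ 2 * quad (fun _ => 1) x₀ q.1 +
    (C / ρ ^ 2 * ((2 * (m + 1) * Lam + 1) * (q.2 - a)) - μ) with hβ
  have hβc : Continuous β := by
    have := quad_continuous (fun _ => 1) x₀
    fun_prop
  have hβ0 : ∀ x t, a ≤ t → -μ ≤ β (x, t) := by
    intro x t ht
    have h1 : 0 ≤ t - a := by linarith
    have : 0 ≤ C / ρ ^ 2 * quad (fun _ => 1) x₀ x := by rw [quad_one]; positivity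
    have : 0 ≤ C / ρ ^ 2 * ((2 * (m + 1) * Lam + 1) * (t - a)) := by positivity
    simp only [hβ]
    linarith
  have key := minimum_principle_singular_bottom hA hlam (v := fun q => w q + β q) (x₀ := x₀)
    (ρ := ρ) (a := a) (T := T) (C := μ - c₀) (S := S) ?_ ?_ ?_ ?_ ?_ ?_ ?_
  · intro x hx t h1 h2
    have := key x hx t h1 h2
    simp only [hβ, quad_one] at this
    linarith
  · intro x hx t h1 h2
    linarith [hlow _ (hΩ x hx t h1 h2), hβ0 x t h1]
  · intro x hx
    linarith [hinit x hx, hβ0 x a le_rfl]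
  · intro x hxS hx t h1 h2
    linarith [hS x hxS hx t h1 h2, hβ0 x t h1]
  · intro x hx t h1 h2
    have h3 := hlow _ (hΩ x hx.le t h1 h2)
    have h1 : 0 ≤ t - a := by linarith
    have : 0 ≤ C / ρ ^ 2 * ((2 * (m + 1) * Lam + 1) * (t - a)) := by positivity
    have h4 : C / ρ ^ 2 * ρ ^ 2 = C := by field_simp
    simp only [hβ, quad_one, hx, h4]
    linarith
  · exact fun x hx t h1 h2 => (hlsc x hx t h1 h2).add_continuousAt hβc.continuousAt
  · exact fun x hx hxS => (hlsc_a x hx hxS).add_continuousAt hβc.continuousAt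
  · intro x hx t h1 h2
    obtain ⟨H, hH, hd⟩ := hw.hasHess (hΩ x hx.le t h1.le h2)
    have hd' : HasDerivAt (fun s => β (x, s)) (C / ρ ^ 2 * (2 * (m + 1) * Lam + 1)) t := by
      have := (((((hasDerivAt_id t).sub_const a).const_mul (2 * (m + 1) * Lam + 1)).const_mul
        (C / ρ ^ 2)).sub_const μ).const_add (C / ρ ^ 2 * quad (fun _ => 1) x₀ x)
      refine (this.congr_deriv (by ring)).congr_of_eventuallyEq (Eventually.of_forall fun s => ?_)
      simp only [hβ, id]
    refine ⟨_, _, hd.add hd', hH.add (((quad_hasHess (fun _ => 1) x₀ x).const_mul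
      (C / ρ ^ 2)).add_const
        (C / ρ ^ 2 * ((2 * (m + 1) * Lam + 1) * (t - a)) - μ)), ?_⟩
    rw [trL_add, trL_smul]
    have h3 := trL_quadHess_le (b := 1) hA hLam.le x (d := fun _ => 1) (by simp) (by simp)
    have : C / ρ ^ 2 * trL A x (quadHess fun _ => 1) < C / ρ ^ 2 * (2 * (m + 1) * Lam + 1) :=
      mul_lt_mul_of_pos_left (by linarith) hCρ
    dsimp only
    linarith

lemma forwardLSC_of_uniform_slices {lam Lam : ℝ}
    {A : Spc m → Matrix (Fin (m + 1)) (Fin (m + 1)) ℝ}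
    (hA : IsElliptic lam Lam A) (hlam : 0 < lam) (hlamLam : lam ≤ Lam)
    {w : Spc m × ℝ → ℝ} {V G : Set (Spc m × ℝ)} (hV : IsOpen V) (hG : IsOpen G)
    (hw : SolvesL A w V) {c₀ : ℝ} (hlow : ∀ p ∈ V, c₀ ≤ w p) {K δ : ℝ} (hK : 0 < K) (hδ : 0 < δ)
    (hslice : ∀ p ∈ V \ G, ∀ y, (y, p.2) ∈ V → ‖y - p.1‖ < δ →
      |w (y, p.2) - w p| ≤ K * ‖y - p.1‖)
    (hfiber : ∀ p ∈ V \ G, ∀ s, (p.1, s) ∈ V → |s - p.2| < δ →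
      w p - K * |s - p.2| ≤ w (p.1, s))
    (hVG : ∀ p ∈ V, p ∈ G → ForwardLSC w p) :
    ∀ p ∈ V, ForwardLSC w p := by
  rintro ⟨xp, tp⟩ hp
  by_cases hpG : (xp, tp) ∈ G
  · exact hVG _ hp hpG
  intro η hη
  have hcont : ContinuousAt (fun s => w (xp, s)) tp := (hw _ hp).2.continuousAt
  obtain ⟨r₁, hr₁, hr₁V⟩ := Metric.isOpen_iff.mp hV _ hp
  obtain ⟨r₂, hr₂, hr₂w⟩ := Metric.continuousAt_iff.mp hcont (η / 8) (by positivity)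
  obtain ⟨ρ, hρ, hρ1, hρ2, hρδ, hρK⟩ :
      ∃ ρ > 0, ρ < r₁ ∧ ρ < r₂ ∧ 2 * ρ < δ ∧ K * (2 * ρ) ≤ η / 8 := by
    refine ⟨min (min (r₁ / 2) (r₂ / 2)) (min (δ / 4) (η / 8 / (2 * K))), by positivity,
      ?_, ?_, ?_, ?_⟩
    · exact (min_le_left _ _).trans_lt ((min_le_left _ _).trans_lt (by linarith))
    · exact (min_le_left _ _).trans_lt ((min_le_right _ _).trans_lt (by linarith))
    · have := (min_le_right (min (r₁ / 2) (r₂ / 2)) _).trans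
        (min_le_left (δ / 4) (η / 8 / (2 * K)))
      linarith
    · have := (min_le_right (min (r₁ / 2) (r₂ / 2)) _).trans
        (min_le_right (δ / 4) (η / 8 / (2 * K)))
      rw [le_div_iff₀ (by positivity)] at this
      linarith
  have hbox : ∀ x t, ‖x - xp‖ ≤ ρ → |t - tp| ≤ ρ → (x, t) ∈ V := by
    intro x t hx ht
    refine hr₁V ?_
    rw [Metric.mem_ball, Prod.dist_eq, dist_eq_norm, Real.dist_eq]
    exact (max_le hx ht).trans_lt hρ1
  have hbad : ∀ x t, ‖x - xp‖ ≤ ρ → |t - tp| ≤ ρ → (x, t) ∉ G → w (xp, tp) - η / 4 ≤ w (x, t) := by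
    intro x t hx ht hG'
    have h1 := hslice (x, t) ⟨hbox x t hx ht, hG'⟩ xp (hbox xp t (by simpa using hρ.le) ht)
      (by dsimp only; rw [norm_sub_rev]; linarith)
    have h2 := hr₂w (x := t) (by rw [Real.dist_eq]; linarith)
    rw [Real.dist_eq] at h2
    dsimp only at h1
    rw [norm_sub_rev] at h1
    have h3 : K * ‖x - xp‖ ≤ K * (2 * ρ) := by gcongr; linarith
    linarith [abs_le.mp h1, abs_lt.mp h2]
  set μ := w (xp, tp) - η / 2 with hμ
  set C := |μ - c₀| + 1 with hC
  have hsmall : ∀ᶠ q : Spc m × ℝ in 𝓝 (xp, tp),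
      C / ρ ^ 2 * (‖q.1 - xp‖ ^ 2 + (2 * (m + 1) * Lam + 1) * (q.2 - tp)) < η / 4 := by
    have hc : Continuous fun q : Spc m × ℝ =>
      C / ρ ^ 2 * (‖q.1 - xp‖ ^ 2 + (2 * (m + 1) * Lam + 1) * (q.2 - tp)) := by fun_prop
    refine (hc.tendsto (xp, tp)).eventually (gt_mem_nhds ?_)
    simpa using hη
  filter_upwards [hsmall, Metric.closedBall_mem_nhds (xp, tp) hρ] with ⟨y, s⟩ hq1 hq2 hq
  dsimp only at hq1 hq
  rw [Metric.mem_closedBall, Prod.dist_eq, dist_eq_norm, Real.dist_eq, max_le_iff] at hq2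
  obtain ⟨hy, hs⟩ := hq2
  dsimp only at hy hs
  have htime : ∀ t, tp ≤ t → t ≤ s → |t - tp| ≤ ρ := fun t h1 h2 => by
    rw [abs_of_nonneg (by linarith)] at hs ⊢
    linarith
  have hcomp : IsCompact ((Metric.closedBall xp ρ ×ˢ Icc tp s) \ G) :=
    ((isCompact_closedBall xp ρ).prod isCompact_Icc).diff hG
  obtain ⟨a, ⟨⟨x', a'⟩, ⟨⟨hx', ha⟩, hxG⟩, rfl⟩, hmax⟩ :=
    (hcomp.image continuous_snd).exists_isGreatest
      ⟨tp, (xp, tp), ⟨⟨Metric.mem_closedBall_self hρ.le, ⟨le_rfl, hq⟩⟩, hpG⟩, rfl⟩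
  dsimp only at hx' ha hmax
  rw [Metric.mem_closedBall, dist_eq_norm] at hx'
  have hfree : ∀ x t, ‖x - xp‖ ≤ ρ → a' < t → t ≤ s → (x, t) ∈ G := by
    intro x t hx h1 h2
    by_contra hn
    refine absurd (hmax ⟨(x, t), ⟨⟨?_, ha.1.trans h1.le, h2⟩, hn⟩, rfl⟩) (not_le.mpr h1)
    simpa [dist_eq_norm] using hx
  have hslice_a : ∀ x, ‖x - xp‖ ≤ ρ → μ ≤ w (x, a') := by
    intro x hx
    have h0 : ‖x - x'‖ ≤ 2 * ρ := by
      rw [← dist_eq_norm] at *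
      linarith [dist_triangle_right x x' xp]
    have h1 := hslice (x', a') ⟨hbox x' a' hx' (htime _ ha.1 ha.2), hxG⟩ x
      (hbox x a' hx (htime _ ha.1 ha.2)) (h0.trans_lt hρδ)
    have h2 := hbad x' a' hx' (htime _ ha.1 ha.2) hxG
    have h3 : K * ‖x - x'‖ ≤ K * (2 * ρ) := by gcongr
    dsimp only at h1
    linarith [abs_le.mp h1]
  rcases ha.2.eq_or_lt with rfl | has
  · linarith [hslice_a y hy]
  have key := lower_bound_above_slice hA hlam hlamLam hw hlow (x₀ := xp) (ρ := ρ) (a := a')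
    (T := s) (μ := μ) (C := C) hρ (by positivity) (by linarith [le_abs_self (μ - c₀)])
    (S := {x | (x, a') ∉ G})
    (fun x hx t h1 h2 => hbox x t hx (htime t (ha.1.trans h1) h2.le)) hslice_a ?_
    (fun x hx t h1 h2 => hVG _ (hbox x t hx (htime t (ha.1.trans h1.le) h2.le))
      (hfree x t hx h1 h2.le))
    (fun x hx hxS => hVG _ (hbox x a' hx (htime a' ha.1 ha.2)) (not_not.mp hxS)) y hy
  · have hct : ContinuousAt (fun t => w (y, t)) s :=
      (hw _ (hbox y s hy hs)).2.continuousAt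
    have : μ - η / 4 ≤ w (y, s) := by
      refine ge_of_tendsto (hct.tendsto.mono_left (nhdsWithin_le_nhds (s := Iio s))) ?_
      filter_upwards [Ioo_mem_nhdsLT has] with t ht
      refine le_trans ?_ (key t ht.1.le ht.2)
      have hCρ : 0 < C / ρ ^ 2 := by positivity
      have hLam : 0 < Lam := hlam.trans_le hlamLam
      have : C / ρ ^ 2 * (‖y - xp‖ ^ 2 + (2 * (m + 1) * Lam + 1) * (t - a')) ≤
          C / ρ ^ 2 * (‖y - xp‖ ^ 2 + (2 * (m + 1) * Lam + 1) * (s - tp)) := by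
        gcongr
        · exact ht.2.le
        · exact ha.1
      linarith
    linarith
  · intro x hxS hx t h1 h2
    have ht := htime t (ha.1.trans h1) h2.le
    have hta : |t - a'| ≤ ρ := by
      have := htime s hq le_rfl
      rw [abs_of_nonneg (by linarith)] at this ⊢
      linarith [ha.1]
    have h3 := hfiber (x, a') ⟨hbox x a' hx (htime _ ha.1 ha.2), hxS⟩ t (hbox x t hx ht)
      (by dsimp only; linarith)
    have h4 := hbad x a' hx (htime _ ha.1 ha.2) hxS
    have h5 : K * |t - a'| ≤ K * (2 * ρ) := by gcongr; linarith
    dsimp only at h3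
    linarith

lemma exists_lipschitz_const {X : Type*} [NormedAddCommGroup X] [NormedSpace ℝ X] {φ : X → ℝ}
    {x : X} (hφ : DifferentiableAt ℝ φ x) :
    ∃ k₀ : ℕ, ∀ k ≥ k₀, ∀ y, ‖y - x‖ < 1 / ((k : ℝ) + 1) →
      |φ y - φ x| ≤ ((k : ℝ) + 1) * ‖y - x‖ := by
  obtain ⟨C, hC⟩ := hφ.hasFDerivAt.isBigO_sub.bound
  obtain ⟨ε, hε, hball⟩ := Metric.eventually_nhds_iff.mp hC
  obtain ⟨k₁, hk₁⟩ := exists_nat_ge C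
  obtain ⟨k₂, hk₂⟩ := exists_nat_one_div_lt hε
  refine ⟨max k₁ k₂, fun k hk y hy => ?_⟩
  have h1 : (k₁ : ℝ) ≤ k := by exact_mod_cast (le_max_left _ _).trans hk
  have h2 : (k₂ : ℝ) ≤ k := by exact_mod_cast (le_max_right _ _).trans hk
  have h3 : 1 / ((k : ℝ) + 1) ≤ 1 / ((k₂ : ℝ) + 1) := by gcongr
  refine (hball (y := y) (by rw [dist_eq_norm]; linarith)).trans ?_
  gcongr
  linarith

/-- A separately regular solution that is bounded below is lower semicontinuous forward in time:
the set of exceptional points has no portion with uniform Lipschitz bounds, hence is empty by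
Baire's theorem. -/
theorem SolvesL.forwardLSC {lam Lam : ℝ}
    {A : Spc m → Matrix (Fin (m + 1)) (Fin (m + 1)) ℝ}
    (hA : IsElliptic lam Lam A) (hlam : 0 < lam) (hlamLam : lam ≤ Lam)
    {w : Spc m × ℝ → ℝ} {Ω : Set (Spc m × ℝ)} (hΩ : IsOpen Ω)
    (hw : SolvesL A w Ω) {c₀ : ℝ} (hlow : ∀ p ∈ Ω, c₀ ≤ w p) :
    ∀ p ∈ Ω, ForwardLSC w p := by
  by_contra! hne
  obtain ⟨p₀, hp₀, hnot⟩ := hne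
  set G : Set (Spc m × ℝ) := {p | ∀ᶠ q in 𝓝 p, ForwardLSC w q} with hGdef
  have hG : IsOpen G := isOpen_setOfPred_eventually_nhds
  have hGlsc : ∀ p ∈ G, ForwardLSC w p := fun p hp => Eventually.self_of_nhds hp
  have hp₀G : p₀ ∉ G := fun h => hnot (hGlsc _ h)
  obtain ⟨ρ, hρ, hρΩ⟩ := Metric.isOpen_iff.mp hΩ _ hp₀
  set P := Metric.ball p₀ ρ with hP
  have hmemP : ∀ {x t}, (x, t) ∈ P ↔ x ∈ Metric.ball p₀.1 ρ ∧ t ∈ Metric.ball p₀.2 ρ := by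
    intro x t
    rw [hP, ← ball_prod_same]
    exact Iff.rfl
  let F : ℕ → Set (Spc m × ℝ) := fun k => {p |
    (∀ y, (y, p.2) ∈ P → ‖y - p.1‖ < 1 / ((k : ℝ) + 1) →
      |w (y, p.2) - w p| ≤ ((k : ℝ) + 1) * ‖y - p.1‖) ∧
    ∀ s, (p.1, s) ∈ P → ‖s - p.2‖ < 1 / ((k : ℝ) + 1) →
      |w (p.1, s) - w p| ≤ ((k : ℝ) + 1) * ‖s - p.2‖}
  have hcover : ∀ p ∈ P, ∃ k, p ∈ F k := by
    intro p hp
    obtain ⟨h1, h2⟩ := hw p (hρΩ hp)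
    obtain ⟨k₁, hk₁⟩ := exists_lipschitz_const (h1.differentiableAt (by norm_num))
    obtain ⟨k₂, hk₂⟩ := exists_lipschitz_const h2.differentiableAt
    exact ⟨max k₁ k₂, fun y _ hy => hk₁ _ (le_max_left _ _) y hy,
      fun s _ hs => hk₂ _ (le_max_right _ _) s hs⟩
  have hcontx : ∀ {x t}, (x, t) ∈ P → ContinuousAt (fun y => w (y, t)) x :=
    fun h => (hw _ (hρΩ h)).1.continuousAt
  have hcontt : ∀ {x t}, (x, t) ∈ P → ContinuousAt (fun s => w (x, s)) t :=
    fun h => (hw _ (hρΩ h)).2.continuousAt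
  have hclosed : ∀ k, ∀ p ∈ P, p ∈ closure (F k) → p ∈ F k := by
    rintro k ⟨x, t⟩ hp hpc
    have hkpos : (0 : ℝ) < 1 / ((k : ℝ) + 1) := by positivity
    have : (𝓝[F k] (x, t)).NeBot := mem_closure_iff_nhdsWithin_neBot.mp hpc
    have hfst : Tendsto (fun q : Spc m × ℝ => q.1) (𝓝[F k] (x, t)) (𝓝 x) :=
      (continuous_fst.tendsto _).mono_left nhdsWithin_le_nhds
    have hsnd : Tendsto (fun q : Spc m × ℝ => q.2) (𝓝[F k] (x, t)) (𝓝 t) :=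
      (continuous_snd.tendsto _).mono_left nhdsWithin_le_nhds
    have hPopen := Metric.isOpen_ball (x := p₀) (ε := ρ)
    have hnorm : ∀ y, Tendsto (fun q : Spc m × ℝ => ‖y - q.1‖) (𝓝[F k] (x, t)) (𝓝 ‖y - x‖) :=
      fun y => (tendsto_const_nhds.sub hfst).norm
    have hnormt : ∀ s, Tendsto (fun q : Spc m × ℝ => ‖s - q.2‖) (𝓝[F k] (x, t)) (𝓝 ‖s - t‖) :=
      fun s => (tendsto_const_nhds.sub hsnd).norm
    have hin : ∀ y s, (y, s) ∈ P → ∀ᶠ q : Spc m × ℝ in 𝓝[F k] (x, t), (y, q.2) ∈ P := by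
      intro y s hys
      filter_upwards [hsnd.eventually (Metric.isOpen_ball.mem_nhds (hmemP.mp hp).2)] with q hq
      exact hmemP.mpr ⟨(hmemP.mp hys).1, hq⟩
    have hin' : ∀ y s, (y, s) ∈ P → ∀ᶠ q : Spc m × ℝ in 𝓝[F k] (x, t), (q.1, s) ∈ P := by
      intro y s hys
      filter_upwards [hfst.eventually (Metric.isOpen_ball.mem_nhds (hmemP.mp hp).1)] with q hq
      exact hmemP.mpr ⟨hq, (hmemP.mp hys).2⟩
    have hwx : Tendsto (fun q : Spc m × ℝ => w (x, q.2)) (𝓝[F k] (x, t)) (𝓝 (w (x, t))) :=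
      (hcontt hp).tendsto.comp hsnd
    have hww : Tendsto w (𝓝[F k] (x, t)) (𝓝 (w (x, t))) := by
      have h0 : Tendsto (fun q : Spc m × ℝ => ((k : ℝ) + 1) * ‖x - q.1‖) (𝓝[F k] (x, t))
          (𝓝 0) := by simpa using (hnorm x).const_mul ((k : ℝ) + 1)
      have h1 : Tendsto (fun q : Spc m × ℝ => w (x, q.2) - w q) (𝓝[F k] (x, t)) (𝓝 0) := by
        refine squeeze_zero_norm' ?_ h0
        filter_upwards [self_mem_nhdsWithin, hin x t hp,
          (hnorm x).eventually (gt_mem_nhds (show ‖x - x‖ < 1 / ((k : ℝ) + 1) by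
            simpa using hkpos))] with q hq h2 h3
        exact hq.1 x h2 h3
      simpa using hwx.sub h1
    refine ⟨fun y hy hyx => ?_, fun s hs hst => ?_⟩
    · refine le_of_tendsto_of_tendsto (((hcontt hy).tendsto.comp hsnd).sub hww).abs
        ((hnorm y).const_mul _) ?_
      filter_upwards [self_mem_nhdsWithin, hin y t hy, (hnorm y).eventually (gt_mem_nhds hyx)]
        with q hq h2 h3 using hq.1 y h2 h3
    · refine le_of_tendsto_of_tendsto (((hcontx hs).tendsto.comp hfst).sub hww).abs
        ((hnormt s).const_mul _) ?_
      filter_upwards [self_mem_nhdsWithin, hin' x s hs, (hnormt s).eventually (gt_mem_nhds hst)]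
        with q hq h2 h3 using hq.2 s h2 h3
  let N : Set (Spc m × ℝ) := P ∩ Gᶜ
  have hNlc : IsLocallyClosed N :=
    ⟨P, Gᶜ, Metric.isOpen_ball, hG.isClosed_compl, rfl⟩
  have : LocallyCompactSpace N := hNlc.locallyCompactSpace
  have : Nonempty N := ⟨⟨p₀, Metric.mem_ball_self hρ, hp₀G⟩⟩
  obtain ⟨k, ⟨p₁, hp₁⟩, hint⟩ := nonempty_interior_of_iUnion_of_closed
    (f := fun k => ((↑) : N → Spc m × ℝ) ⁻¹' F k)
    (fun k => isClosed_of_closure_subset fun q hq =>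
      hclosed k q q.2.1 (continuous_subtype_val.closure_preimage_subset _ hq))
    (eq_univ_of_forall fun q => mem_iUnion.mpr (hcover q q.2.1))
  rw [mem_interior_iff_mem_nhds, mem_nhds_subtype] at hint
  obtain ⟨U, hU, hUF⟩ := hint
  obtain ⟨V, hVU, hVopen, hpV⟩ := mem_nhds_iff.mp
    (inter_mem hU (Metric.isOpen_ball.mem_nhds hp₁.1))
  have hVF : ∀ p ∈ V \ G, p ∈ F k := fun p hp =>
    hUF (show (⟨p, (hVU hp.1).2, hp.2⟩ : N) ∈ ((↑) : N → Spc m × ℝ) ⁻¹' U from (hVU hp.1).1)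
  refine hp₁.2 ?_
  have hall := forwardLSC_of_uniform_slices hA hlam hlamLam hVopen hG
    (fun p hp => hw p (hρΩ (hVU hp).2)) (fun p hp => hlow p (hρΩ (hVU hp).2))
    (K := (k : ℝ) + 1) (δ := 1 / ((k : ℝ) + 1)) (by positivity) (by positivity)
    (fun p hp y hy hyp => (hVF p hp).1 y (hVU hy).2 hyp)
    (fun p hp s hs hsp => by
      have := (hVF p hp).2 s (hVU hs).2 hsp
      rw [Real.norm_eq_abs] at this
      linarith [abs_le.mp this])
    (fun p _ hp => hGlsc p hp)
  filter_upwards [hVopen.mem_nhds hpV] with q hq using hall q hq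

end ForwardSemicontinuity

section Barrier

variable {m : ℕ}

lemma exp_quad_hasHess (d : Fin (m + 1) → ℝ) (y x : Spc m) (α s : ℝ) :
    HasHess (fun x => Real.exp (α * (s - quad d y x))) x
      ((α ^ 2 * Real.exp (α * (s - quad d y x))) •
          (quadHess d (x - y)).smulRight (quadHess d (x - y)) +
        (-α * Real.exp (α * (s - quad d y x))) • quadHess d) := by
  have h1 : ∀ x, HasFDerivAt (fun x => Real.exp (α * (s - quad d y x)))
      ((-α * Real.exp (α * (s - quad d y x))) • quadHess d (x - y)) x := by
    intro x
    refine (((quad_hasFDerivAt d y x).const_sub s).const_mul α).exp.congr_fderiv ?_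
    refine ContinuousLinearMap.ext fun v => ?_
    simp
    ring
  obtain ⟨G, hG, hH⟩ := quad_hasHess d y x
  refine ⟨_, Eventually.of_forall h1, ?_⟩
  refine (((h1 x).const_mul (-α)).smul
    ((quadHess d).hasFDerivAt.comp x ((hasFDerivAt_id x).sub_const y))).congr_fderiv ?_
  refine ContinuousLinearMap.ext fun v => ContinuousLinearMap.ext fun u => ?_
  simp
  ring

lemma IsElliptic.le_trL_smulRight {lam Lam : ℝ}
    {A : Spc m → Matrix (Fin (m + 1)) (Fin (m + 1)) ℝ} (hA : IsElliptic lam Lam A)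
    (hlam : 0 < lam) {d : Fin (m + 1) → ℝ} (hd : ∀ i, 1 ≤ d i) (y x : Spc m) :
    4 * lam * quad d y x ≤
      trL A x ((quadHess d (x - y)).smulRight (quadHess d (x - y))) := by
  have h1 := (hA.2 x (WithLp.toLp 2 fun i => quadHess d (x - y) (eVec m i))).1
  have h2 : trL A x ((quadHess d (x - y)).smulRight (quadHess d (x - y))) =
      ∑ i, ∑ j, quadHess d (x - y) (eVec m i) * A x i j * quadHess d (x - y) (eVec m j) :=
    Finset.sum_congr rfl fun i _ => Finset.sum_congr rfl fun j _ => by simp; ring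
  rw [h2]
  refine le_trans ?_ h1
  rw [EuclideanSpace.norm_sq_eq, quad, Finset.mul_sum, Finset.mul_sum]
  refine Finset.sum_le_sum fun i _ => ?_
  simp only [quadHess_eVec, Real.norm_eq_abs, sq_abs, PiLp.sub_apply]
  have h3 := mul_nonneg (mul_nonneg hlam.le (mul_nonneg (by linarith [hd i] : 0 ≤ d i)
    (sub_nonneg.mpr (hd i)))) (sq_nonneg (x i - y i))
  nlinarith

lemma norm_sq_le_quad {d : Fin (m + 1) → ℝ} (hd : ∀ i, 1 ≤ d i) (y x : Spc m) :
    ‖x - y‖ ^ 2 ≤ quad d y x := by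
  rw [← quad_one]
  refine Finset.sum_le_sum fun i _ => ?_
  exact mul_le_mul_of_nonneg_right (hd i) (sq_nonneg _)

/-- Comparison with the barrier `exp (α (σ(t) - q(x)))` in the expanding paraboloid `q < σ`. -/
lemma barrier_le {lam Lam : ℝ} {A : Spc m → Matrix (Fin (m + 1)) (Fin (m + 1)) ℝ}
    (hA : IsElliptic lam Lam A) (hlam : 0 < lam) (hlamLam : lam ≤ Lam)
    {w : Spc m × ℝ → ℝ} {Ω : Set (Spc m × ℝ)} (hΩ : IsOpen Ω) (hw : SolvesL A w Ω)
    (hlsc : ∀ p ∈ Ω, ForwardLSC w p) {d : Fin (m + 1) → ℝ} {b : ℝ} (hd : ∀ i, 1 ≤ d i)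
    (hdb : ∀ i, d i ≤ b) {y : Spc m} {α κ σ₀ t₁ t₀ S μ : ℝ} (hα : 0 < α) (hκ : 0 < κ)
    (hμ : 0 < μ) (hακ : κ + 2 * (m + 1) * b * Lam < 4 * α * lam * σ₀)
    (hcl : ∀ p ∈ closure Ω, quad d y p.1 ≤ σ₀ + κ * (p.2 - t₁) → t₁ ≤ p.2 → p.2 < t₀ →
      (∀ η > 0, ∀ᶠ q in 𝓝 p, q ∈ Ω → p.2 ≤ q.2 → μ - S - η ≤ w q) ∨
      (p ∈ Ω ∧ -S ≤ w p ∧ σ₀ < quad d y p.1)) :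
    ∀ p ∈ Ω, quad d y p.1 < σ₀ + κ * (p.2 - t₁) → t₁ < p.2 → p.2 < t₀ →
      μ * ((Real.exp (α * (σ₀ + κ * (p.2 - t₁) - quad d y p.1)) - 2) /
        Real.exp (α * (σ₀ + κ * (t₀ - t₁)))) - S ≤ w p := by
  set E := Real.exp (α * (σ₀ + κ * (t₀ - t₁))) with hE
  have hE0 : 0 < E := Real.exp_pos _
  set e : Spc m × ℝ → ℝ :=
    fun p => Real.exp (α * (σ₀ + κ * (p.2 - t₁) - quad d y p.1)) with he
  have hq := quad_continuous d y
  have hec : Continuous e := by fun_prop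
  have hq0 : ∀ x, 0 ≤ quad d y x := fun x => (sq_nonneg _).trans (norm_sq_le_quad hd y x)
  set β : Spc m × ℝ → ℝ := fun p => -(μ / E) * e p + (2 * (μ / E) + S) with hβ
  have hβc : Continuous β := by fun_prop
  have hμE : 0 < μ / E := by positivity
  set D : Set (Spc m × ℝ) :=
    Ω ∩ ({p | quad d y p.1 < σ₀ + κ * (p.2 - t₁)} ∩ ({p | t₁ < p.2} ∩ {p | p.2 < t₀})) with hD
  have hDo : IsOpen D := hΩ.inter
    ((isOpen_lt (by fun_prop) (by fun_prop)).inter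
      ((isOpen_lt (by fun_prop) (by fun_prop)).inter (isOpen_lt (by fun_prop) (by fun_prop))))
  have hDb : Bornology.IsBounded D := by
    have hb : Bornology.IsBounded (Metric.closedBall y (σ₀ + κ * (t₀ - t₁) + 1) ×ˢ Icc t₁ t₀) :=
      Metric.isBounded_closedBall.prod (Metric.isBounded_Icc t₁ t₀)
    refine hb.subset ?_
    rintro ⟨x, t⟩ ⟨-, h1, h2, h3⟩
    change quad d y x < σ₀ + κ * (t - t₁) at h1
    change t₁ < t at h2
    change t < t₀ at h3
    refine ⟨?_, h2.le, h3.le⟩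
    rw [Metric.mem_closedBall, dist_eq_norm]
    have h4 := norm_sq_le_quad hd y x
    have h5 : κ * (t - t₁) ≤ κ * (t₀ - t₁) := by gcongr
    nlinarith [sq_nonneg (‖x - y‖ - 1), norm_nonneg (x - y)]
  have hDcl : ∀ p ∈ closure D, p ∈ closure Ω ∧ quad d y p.1 ≤ σ₀ + κ * (p.2 - t₁) ∧ t₁ ≤ p.2 := by
    intro p hp
    have hsub : D ⊆ {p | quad d y p.1 ≤ σ₀ + κ * (p.2 - t₁)} ∩ {p | t₁ ≤ p.2} :=
      fun q hq => ⟨show quad d y q.1 ≤ σ₀ + κ * (q.2 - t₁) from le_of_lt hq.2.1,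
        show t₁ ≤ q.2 from le_of_lt hq.2.2.1⟩
    have := closure_minimal hsub ((isClosed_le (by fun_prop) (by fun_prop)).inter
      (isClosed_le (by fun_prop) (by fun_prop))) hp
    exact ⟨closure_mono inter_subset_left hp, this.1, this.2⟩
  have key := minimum_principle hA hlam (f := fun p => w p + β p) (D := D) (T := t₀) hDb
    (fun p hp => hp.2.2.2) ?_
  · intro p hp h1 h2 h3
    have := key p ⟨hp, h1, h2, h3⟩
    simp only [hβ, he] at this
    have h4 : ∀ z : ℝ, μ * ((z - 2) / E) - S = μ / E * z - (2 * (μ / E) + S) := fun z => by ring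
    rw [h4]
    linarith
  intro p hp hpt
  obtain ⟨hpΩ, hpq, hp1⟩ := hDcl p hp
  rcases hcl p hpΩ hpq hp1 hpt with hsafe | ⟨hpΩ, hpS, hpσ⟩
  · left
    filter_upwards [hsafe (2 * (μ / E)) (by positivity)] with q hq1 hqD hqt
    have h1 := hq1 hqD.1 hqt
    have h2 : e q ≤ E := by
      refine Real.exp_le_exp.mpr (mul_le_mul_of_nonneg_left ?_ hα.le)
      have : κ * (q.2 - t₁) ≤ κ * (t₀ - t₁) := by gcongr; exact hqD.2.2.2.le
      linarith [hq0 q.1]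
    have h3 : μ / E * e q ≤ μ / E * E := by gcongr
    have h4 : μ / E * E = μ := by field_simp
    simp only [hβ]
    linarith
  rcases hpq.eq_or_lt with heq | hlt
  · left
    have hep : e p = 1 := by simp [he, heq]
    filter_upwards [(hlsc p hpΩ).add_continuousAt hβc.continuousAt (μ / E) hμE] with q hq1 _ hqt
    have := hq1 hqt
    simp only [hβ, hep] at this
    simp only [hβ]
    linarith
  right
  have hpt1 : t₁ < p.2 := by
    by_contra! hn
    nlinarith
  have hpD : p ∈ D := ⟨hpΩ, hlt, hpt1, hpt⟩
  have hDn := hDo.mem_nhds hpD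
  refine ⟨hpD, ?_, ?_, (hlsc p hpΩ).add_continuousAt hβc.continuousAt, ?_⟩
  · exact (Continuous.tendsto (by fun_prop : Continuous fun y : Spc m => (y, p.2)) p.1).eventually
      hDn
  · exact ((Continuous.tendsto (by fun_prop : Continuous fun s : ℝ => (p.1, s)) p.2).eventually
      hDn).filter_mono nhdsWithin_le_nhds
  obtain ⟨H, hH, hd1⟩ := hw.hasHess hpΩ
  have hde : HasDerivAt (fun s => β (p.1, s)) (-(μ / E) * (e p * (α * κ))) p.2 := by
    have := ((((((hasDerivAt_id p.2).sub_const t₁).const_mul κ).const_add σ₀).sub_const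
      (quad d y p.1)).const_mul α).exp
    refine ((this.const_mul (-(μ / E))).add_const (2 * (μ / E) + S)).congr_deriv ?_
    simp [he]
  refine ⟨_, _, hd1.add hde, hH.add (((exp_quad_hasHess d y p.1 α
    (σ₀ + κ * (p.2 - t₁))).const_mul (-(μ / E))).add_const (2 * (μ / E) + S)), ?_⟩
  rw [trL_add, trL_smul, trL_add, trL_smul, trL_smul]
  have hLam : 0 ≤ Lam := (hlam.trans_le hlamLam).le
  have h1 := trL_quadHess_le hA hLam p.1 (fun i => zero_le_one.trans (hd i)) hdb
  have h2 := hA.le_trL_smulRight hlam hd y p.1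
  have hep : 0 < e p := Real.exp_pos _
  change _ + -(μ / E) * (α ^ 2 * e p * _ + -α * e p * _) < _
  set X := trL A p.1 ((quadHess d (p.1 - y)).smulRight (quadHess d (p.1 - y)))
  set Y := trL A p.1 (quadHess d)
  have h3 : 4 * lam * σ₀ < 4 * lam * quad d y p.1 := by gcongr
  have h4 : α * κ < α * (α * X - Y) := by
    refine mul_lt_mul_of_pos_left ?_ hα
    have : α * (4 * lam * σ₀) < α * X := mul_lt_mul_of_pos_left (h3.trans_le h2) hα
    linarith
  have h5 := mul_lt_mul_of_pos_left h4 (mul_pos hμE hep)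
  linarith

end Barrier

section Propagation

variable {m : ℕ}

lemma xlast_continuous : Continuous (xlast : Spc m → ℝ) := by
  unfold xlast
  fun_prop

lemma xprime_continuous : Continuous (xprime : Spc m → Spc' m) :=
  (PiLp.continuous_toLp 2 _).comp (by fun_prop : Continuous fun x : Spc m => fun i : Fin m =>
    x i.castSucc)

lemma norm_sq_xprime_sub (x y : Spc m) :
    ‖xprime x - xprime y‖ ^ 2 = ∑ i : Fin m, (x i.castSucc - y i.castSucc) ^ 2 := by
  simp [EuclideanSpace.norm_sq_eq, xprime]

lemma quad_add_vertical (b c : ℝ) (x z : Spc m) :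
    quad (fun i => if i = Fin.last m then 1 else b) (x + c • eVec m (Fin.last m)) z =
      b * ‖xprime z - xprime x‖ ^ 2 + (xlast z - xlast x - c) ^ 2 := by
  rw [quad, Fin.sum_univ_castSucc, norm_sq_xprime_sub, Finset.mul_sum]
  congr 1
  · refine Finset.sum_congr rfl fun i _ => ?_
    simp [eVec, Fin.castSucc_ne_last]
  · simp [eVec, xlast, sub_sub]

/-- Lower bounds propagate across a distance comparable to `h` with constant `θ`: if `w ≥ μ - S`
on the part of the boundary of `Ω` near `(x₀, t₀)` and in the hole around `x₀ + c eₙ`, and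
`w ≥ -S` elsewhere, then `w ≥ μθ - S` at `(x₀, t₀)`. -/
def PropagatesWith (m : ℕ) (lam Lam ε θ : ℝ) : Prop :=
  ∀ A : Spc m → Matrix (Fin (m + 1)) (Fin (m + 1)) ℝ, IsElliptic lam Lam A →
  ∀ (w : Spc m × ℝ → ℝ) (Ω : Set (Spc m × ℝ)), IsOpen Ω → SolvesL A w Ω →
    (∀ p ∈ Ω, ForwardLSC w p) →
  ∀ (h : ℝ) (x₀ : Spc m) (t₀ c S μ : ℝ), 0 < h → c ^ 2 = (3 / 2 * h) ^ 2 → 0 < μ →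
    ContinuousAt (fun s => w (x₀, s)) t₀ → (∀ᶠ t in 𝓝[<] t₀, (x₀, t) ∈ Ω) →
    (∀ p ∈ closure Ω, p.2 < t₀ → |p.2 - t₀| ≤ (ε * h) ^ 2 →
      ‖xprime p.1 - xprime x₀‖ ≤ ε * h → |xlast p.1 - xlast x₀ - c| ≤ 7 / 4 * h →
      (∀ η > 0, ∀ᶠ q in 𝓝 p, q ∈ Ω → p.2 ≤ q.2 → μ - S - η ≤ w q) ∨
      (p ∈ Ω ∧ -S ≤ w p ∧ h / 4 < |xlast p.1 - xlast x₀ - c|)) →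
    μ * θ - S ≤ w (x₀, t₀)

lemma exists_propagatesWith (m : ℕ) {lam Lam ε : ℝ} (hlam : 0 < lam) (hlamLam : lam ≤ Lam)
    (hε : 0 < ε) (hε1 : ε ≤ 1) : ∃ θ : ℝ, 0 < θ ∧ θ < 1 ∧ PropagatesWith m lam Lam ε θ := by
  set b : ℝ := (7 / (4 * ε)) ^ 2 with hb
  have hbε : b * ε ^ 2 = 49 / 16 := by rw [hb]; field_simp; norm_num
  have hb1 : 1 ≤ b := by nlinarith [sq_nonneg ε, mul_self_nonneg (1 - ε)]
  have hLam : 0 < Lam := hlam.trans_le hlamLam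
  set κ : ℝ := 3 / ε ^ 2 with hκ
  have hκ0 : 0 < κ := by positivity
  have hκε : κ * ε ^ 2 = 3 := by rw [hκ]; field_simp
  set α₀ : ℝ := 2 + 4 * (κ + 2 * (m + 1) * b * Lam) / lam with hα₀
  have hα2 : 2 ≤ α₀ := by
    have : 0 ≤ 4 * (κ + 2 * (m + 1) * b * Lam) / lam := by positivity
    linarith
  refine ⟨(Real.exp (α₀ * (13 / 16)) - 2) / Real.exp (α₀ * (49 / 16)), ?_, ?_, ?_⟩
  · refine div_pos ?_ (Real.exp_pos _)
    linarith [Real.add_one_le_exp (α₀ * (13 / 16))]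
  · rw [div_lt_one (Real.exp_pos _)]
    have : Real.exp (α₀ * (13 / 16)) ≤ Real.exp (α₀ * (49 / 16)) := by gcongr; norm_num
    linarith
  intro A hA w Ω hΩ hw hlsc h x₀ t₀ c S μ hh hc hμ hcont hev hcl
  set d : Fin (m + 1) → ℝ := fun i => if i = Fin.last m then 1 else b with hd
  set y : Spc m := x₀ + c • eVec m (Fin.last m) with hy
  have hd1 : ∀ i, 1 ≤ d i := fun i => by simp only [hd]; split_ifs <;> linarith
  have hdb : ∀ i, d i ≤ b := fun i => by simp only [hd]; split_ifs <;> linarith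
  have hquad : ∀ z, quad d y z = b * ‖xprime z - xprime x₀‖ ^ 2 + (xlast z - xlast x₀ - c) ^ 2 :=
    quad_add_vertical b c x₀
  set t₁ := t₀ - (ε * h) ^ 2 with ht₁
  have ht10 : t₁ < t₀ := by rw [ht₁]; linarith [show 0 < (ε * h) ^ 2 by positivity]
  have hσ : h ^ 2 / 16 + κ * (t₀ - t₁) = 49 / 16 * h ^ 2 := by
    rw [ht₁]; linear_combination h ^ 2 * hκε
  have hακ : κ + 2 * (m + 1) * b * Lam < 4 * (α₀ / h ^ 2) * lam * (h ^ 2 / 16) := by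
    have : 4 * (α₀ / h ^ 2) * lam * (h ^ 2 / 16) =
        lam / 2 + (κ + 2 * (m + 1) * b * Lam) := by rw [hα₀]; field_simp; ring
    linarith
  have key := barrier_le hA hlam hlamLam hΩ hw hlsc hd1 hdb (y := y) (α := α₀ / h ^ 2) (κ := κ)
    (σ₀ := h ^ 2 / 16) (t₁ := t₁) (t₀ := t₀) (S := S) (μ := μ) (by positivity) hκ0 hμ hακ ?_
  · have hx₀ : quad d y x₀ = 9 / 4 * h ^ 2 := by rw [hquad]; simp [hc]; ring
    have hlim : Tendsto (fun t => μ * ((Real.exp (α₀ / h ^ 2 * (h ^ 2 / 16 + κ * (t - t₁) -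
        quad d y x₀)) - 2) / Real.exp (α₀ / h ^ 2 * (h ^ 2 / 16 + κ * (t₀ - t₁)))) - S)
        (𝓝[<] t₀) (𝓝 (μ * ((Real.exp (α₀ * (13 / 16)) - 2) / Real.exp (α₀ * (49 / 16))) - S)) := by
      have h1 : α₀ / h ^ 2 * (h ^ 2 / 16 + κ * (t₀ - t₁) - quad d y x₀) = α₀ * (13 / 16) := by
        rw [hσ, hx₀]; field_simp; ring
      have h2 : α₀ / h ^ 2 * (h ^ 2 / 16 + κ * (t₀ - t₁)) = α₀ * (49 / 16) := by
        rw [hσ]; field_simp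
      rw [← h1, ← h2]
      exact (Continuous.tendsto (by fun_prop) t₀).mono_left nhdsWithin_le_nhds
    refine le_of_tendsto_of_tendsto hlim (hcont.tendsto.mono_left nhdsWithin_le_nhds) ?_
    have hq : ∀ᶠ t in 𝓝[<] t₀, quad d y x₀ < h ^ 2 / 16 + κ * (t - t₁) := by
      have hct : Continuous fun t => h ^ 2 / 16 + κ * (t - t₁) := by fun_prop
      refine ((hct.tendsto t₀).mono_left nhdsWithin_le_nhds).eventually (lt_mem_nhds ?_)
      rw [hσ, hx₀]
      linarith [show 0 < h ^ 2 by positivity]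
    filter_upwards [hev, hq, Ioo_mem_nhdsLT ht10] with t h1 h2 h3 
      using key (x₀, t) h1 h2 h3.1 h3.2
  · intro p hp h1 h2 h3
    rw [hquad] at h1 ⊢
    have h4 : κ * (p.2 - t₁) ≤ κ * (t₀ - t₁) := by gcongr
    have h5 := sq_nonneg (xlast p.1 - xlast x₀ - c)
    have h6 : 0 ≤ b * ‖xprime p.1 - xprime x₀‖ ^ 2 := by positivity
    have hb0 : 0 < b := by linarith
    have ht : |p.2 - t₀| ≤ (ε * h) ^ 2 := by
      rw [abs_sub_comm, abs_of_nonneg (by linarith)]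
      linarith
    have hx' : ‖xprime p.1 - xprime x₀‖ ≤ ε * h := by
      refine (sq_le_sq₀ (norm_nonneg _) (by positivity)).mp (le_of_mul_le_mul_left ?_ hb0)
      linear_combination h1 + h4 + h5 + hσ - h ^ 2 * hbε
    have hxn : |xlast p.1 - xlast x₀ - c| ≤ 7 / 4 * h := by
      refine (sq_le_sq₀ (abs_nonneg _) (by positivity)).mp ?_
      rw [sq_abs]
      linarith
    rcases hcl p hp h3 ht hx' hxn with hs | ⟨h7, h8, h9⟩
    · exact Or.inl hs
    · refine Or.inr ⟨h7, h8, ?_⟩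
      have := (sq_lt_sq₀ (by positivity) (abs_nonneg _)).mpr h9
      rw [sq_abs] at this
      linarith

end Propagation

section Cylinder

variable {m : ℕ} {g : Spc' m → ℝ → ℝ} {r K : ℝ}

lemma hGamma_continuous (hg : Continuous fun q : Spc' m × ℝ => g q.1 q.2) :
    Continuous (hGamma g) := by
  have h1 : Continuous fun p : Spc m × ℝ => g (xprime p.1) p.2 :=
    hg.comp (((xprime_continuous (m := m)).comp continuous_fst).prodMk continuous_snd)
  exact ((xlast_continuous (m := m)).comp continuous_fst).sub h1

/-- The points of `𝒞_r^−` at horizontal distance more than `s` and time more than `τ` from the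
sides and the bottom. -/
def innerCyl (g : Spc' m → ℝ → ℝ) (r s τ : ℝ) : Set (Spc m × ℝ) :=
  {p | (∀ i, |xprime p.1 i| < r - s) ∧ -r ^ 2 + τ < p.2 ∧ p.2 ≤ 0 ∧
    0 < hGamma g p ∧ hGamma g p < r}

lemma innerCyl_zero : innerCyl g r 0 0 = CylB g r := by
  ext p
  simp [innerCyl, CylB, hGamma, abs_lt, sub_lt_iff_lt_add']

/-- The part of `𝒞_r^−` strictly before time `0`. -/
def openCyl (g : Spc' m → ℝ → ℝ) (r : ℝ) : Set (Spc m × ℝ) := innerCyl g r 0 0 ∩ {p | p.2 < 0}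

lemma isOpen_openCyl (hg : Continuous fun q : Spc' m × ℝ => g q.1 q.2) :
    IsOpen (openCyl g r) := by
  have h1 : openCyl g r = (⋂ i, {p | |xprime p.1 i| < r - 0}) ∩ ({p | -r ^ 2 + 0 < p.2} ∩
      ({p | p.2 < 0} ∩ ({p | 0 < hGamma g p} ∩ {p | hGamma g p < r}))) := by
    ext p
    simp only [openCyl, innerCyl, mem_inter_iff, mem_iInter, mem_ofPred_eq]
    exact ⟨fun h => ⟨h.1.1, h.1.2.1, h.2, h.1.2.2.2⟩,
      fun h => ⟨⟨h.1, h.2.1, h.2.2.1.le, h.2.2.2⟩, h.2.2.1⟩⟩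
  have hG := hGamma_continuous hg
  have hx := xprime_continuous (m := m)
  rw [h1]
  refine (isOpen_iInter_of_finite fun i => isOpen_lt ?_ continuous_const).inter
    ((isOpen_lt (by fun_prop) (by fun_prop)).inter
      ((isOpen_lt (by fun_prop) (by fun_prop)).inter
        ((isOpen_lt (by fun_prop) (by fun_prop)).inter (isOpen_lt (by fun_prop) (by fun_prop)))))
  fun_prop

lemma eventually_mem_openCyl (hg : Continuous fun q : Spc' m × ℝ => g q.1 q.2) {p : Spc m × ℝ}
    (hp : p ∈ CylB g r) : ∀ᶠ t in 𝓝[<] p.2, (p.1, t) ∈ openCyl g r := by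
  rw [← innerCyl_zero] at hp
  obtain ⟨h1, h2, h3, h4, h5⟩ := hp
  have hc : Tendsto (fun t => hGamma g (p.1, t)) (𝓝[<] p.2) (𝓝 (hGamma g p)) :=
    (Continuous.tendsto ((hGamma_continuous hg).comp (by fun_prop : Continuous fun t : ℝ =>
      (p.1, t))) p.2).mono_left nhdsWithin_le_nhds
  filter_upwards [hc.eventually (lt_mem_nhds h4), hc.eventually (gt_mem_nhds h5),
    Ioo_mem_nhdsLT h2] with t h6 h7 h8
  exact ⟨⟨h1, h8.1, h8.2.le.trans h3, h6, h7⟩, h8.2.trans_le h3⟩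

lemma HolderSemi.abs_hGamma_sub_le (hgK : HolderSemi 1 (1 / 2) K g) (hK : 0 < K) {h : ℝ}
    (hh : 0 < h) {p q : Spc m × ℝ} (ht : |p.2 - q.2| ≤ (1 / (16 * (K + 1)) * h) ^ 2)
    (hx : ‖xprime p.1 - xprime q.1‖ ≤ 1 / (16 * (K + 1)) * h) :
    |hGamma g p - hGamma g q - (xlast p.1 - xlast q.1)| ≤ h / 8 := by
  have h1 := hgK (xprime p.1) (xprime q.1) p.2 q.2
  have h2 : |p.2 - q.2| ^ (1 / 2 : ℝ) ≤ 1 / (16 * (K + 1)) * h := by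
    rw [← Real.sqrt_eq_rpow]
    exact Real.sqrt_le_iff.mpr ⟨by positivity, ht⟩
  rw [Real.rpow_one] at h1
  have h3 : K * (‖xprime p.1 - xprime q.1‖ + |p.2 - q.2| ^ (1 / 2 : ℝ)) ≤
      (K + 1) * (1 / (16 * (K + 1)) * h + 1 / (16 * (K + 1)) * h) := by
    gcongr
    linarith
  have h4 : (K + 1) * (1 / (16 * (K + 1)) * h + 1 / (16 * (K + 1)) * h) = h / 8 := by
    field_simp
    norm_num
  rw [show hGamma g p - hGamma g q - (xlast p.1 - xlast q.1) =
    -(g (xprime p.1) p.2 - g (xprime q.1) q.2) by unfold hGamma; ring, abs_neg]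
  linarith

lemma mem_innerCyl_of_near {s τ h ε : ℝ} (hε : 0 < ε) (hε1 : ε ≤ 1) (hh : 0 < h)
    {p q : Spc m × ℝ} (hq : q ∈ innerCyl g r (s + h) (τ + h ^ 2)) (hpq : p.2 < q.2)
    (ht : |p.2 - q.2| ≤ (ε * h) ^ 2) (hx : ‖xprime p.1 - xprime q.1‖ ≤ ε * h)
    (h0 : 0 < hGamma g p) (hr : hGamma g p < r) : p ∈ innerCyl g r s τ ∩ {p | p.2 < 0} := by
  obtain ⟨h1, h2, h3, -, -⟩ := hq
  have hεh : ε * h ≤ h := mul_le_of_le_one_left hh.le hε1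
  refine ⟨⟨fun i => ?_, ?_, (hpq.trans_le h3).le, h0, hr⟩, hpq.trans_le h3⟩
  · have h4 : |xprime p.1 i - xprime q.1 i| ≤ ‖xprime p.1 - xprime q.1‖ :=
      PiLp.norm_apply_le (xprime p.1 - xprime q.1) i
    have h5 := abs_sub_abs_le_abs_sub (xprime p.1 i) (xprime q.1 i)
    linarith [h1 i]
  · have h4 : (ε * h) ^ 2 ≤ h ^ 2 := by gcongr
    linarith [(abs_le.mp ht).1]

end Cylinder

section Iteration

variable {m : ℕ} {g : Spc' m → ℝ → ℝ} {r K lam Lam M h θ : ℝ}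
  {A : Spc m → Matrix (Fin (m + 1)) (Fin (m + 1)) ℝ} {w : Spc m × ℝ → ℝ}

lemma one_sub_mul_le_of_near_graph (hK : 0 < K) (hlam : 0 < lam) (hlamLam : lam ≤ Lam)
    (hθ : PropagatesWith m lam Lam (1 / (16 * (K + 1))) θ) (hθ1 : θ < 1)
    (hA : IsElliptic lam Lam A) (hg : Continuous fun q : Spc' m × ℝ => g q.1 q.2)
    (hgK : HolderSemi 1 (1 / 2) K g) (hw : SolvesL A w (CylB g r))
    (hvan : VanishesOn (fun q => max (-w q) 0) (CylB g r) (graphSet g)) (hM : 0 < M)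
    (hh : 0 < h) (hhr : h < r) (hwM : ∀ p ∈ CylB g r, h ≤ hGamma g p → M ≤ w p)
    (hw1 : ∀ p ∈ CylB g r, -1 ≤ w p) {S s τ : ℝ} (hS : 0 < S)
    (hs : 0 ≤ s) (hτ : 0 ≤ τ) (hwS : ∀ p ∈ innerCyl g r s τ, -S ≤ w p) :
    ∀ p ∈ innerCyl g r (s + h) (τ + h ^ 2), -((1 - θ) * S) ≤ w p := by
  rintro ⟨x₀, t₀⟩ hp₀
  have hmono : ∀ {s τ}, 0 ≤ s → 0 ≤ τ → ∀ p ∈ innerCyl g r s τ, p ∈ CylB g r := by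
    rintro s τ hs hτ p ⟨h1, h2, h3⟩
    rw [← innerCyl_zero]
    exact ⟨fun i => (h1 i).trans_le (by linarith), by linarith, h3⟩
  have hp₀C := hmono (by positivity) (by positivity) _ hp₀
  have hε : 0 < 1 / (16 * (K + 1)) := by positivity
  have hε1 : 1 / (16 * (K + 1)) ≤ 1 := by rw [div_le_one (by positivity)]; linarith
  rcases le_or_gt h (hGamma g (x₀, t₀)) with hhigh | hlow
  · have : 0 ≤ (1 - θ) * S := mul_nonneg (by linarith) hS.le
    linarith [hwM _ hp₀C hhigh]
  have hsub : openCyl g r ⊆ CylB g r := fun p hp => innerCyl_zero (g := g) ▸ hp.1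
  have hlsc := SolvesL.forwardLSC hA hlam hlamLam (isOpen_openCyl hg)
    (fun p hp => hw p (hsub hp)) (fun p hp => hw1 p (hsub hp))
  have hGc := hGamma_continuous hg
  have hev := eventually_mem_openCyl hg hp₀C
  have hev' : ∀ᶠ t in 𝓝[<] t₀, hGamma g (x₀, t) < h :=
    (((Continuous.tendsto (hGc.comp (by fun_prop : Continuous fun t : ℝ => (x₀, t))) t₀).mono_left
      nhdsWithin_le_nhds)).eventually (gt_mem_nhds hlow)
  have key := hθ A hA w (openCyl g r ∩ {p | hGamma g p < h})
    ((isOpen_openCyl hg).inter (isOpen_lt hGc continuous_const)) (fun p hp => hw p (hsub hp.1))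
    (fun p hp => hlsc p hp.1) h x₀ t₀ (-(3 / 2 * h)) S S hh (by ring) hS
    (hw _ hp₀C).2.continuousAt (hev.and hev') ?_
  · linarith
  intro p hp hpt ht hx hxn
  have hcl : openCyl g r ∩ {p | hGamma g p < h} ⊆ {p | 0 ≤ hGamma g p} ∩ {p | hGamma g p ≤ h} :=
    fun q hq => ⟨show 0 ≤ hGamma g q from hq.1.1.2.2.2.1.le,
      show hGamma g q ≤ h from le_of_lt hq.2⟩
  obtain ⟨h0, h1⟩ := closure_minimal hcl ((isClosed_le continuous_const hGc).inter
    (isClosed_le hGc continuous_const)) hp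
  change 0 ≤ hGamma g p at h0
  change hGamma g p ≤ h at h1
  rcases h0.eq_or_lt with h0 | h0
  · left
    have hpΓ : p ∈ graphSet g := by
      change xlast p.1 = _
      unfold hGamma at h0
      linarith
    have := hvan p ⟨hpΓ, closure_mono (inter_subset_left.trans hsub) hp⟩
    intro η hη
    have h2 := eventually_nhdsWithin_iff.mp (this.eventually (gt_mem_nhds hη))
    filter_upwards [h2] with q hq hqΩ _
    linarith [le_max_left (-w q) 0, hq (hsub hqΩ.1)]
  have hmem := mem_innerCyl_of_near hε hε1 hh hp₀ hpt ht hx h0 (h1.trans_lt hhr)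
  have hpC := hmono hs hτ p hmem.1
  have hpO : p ∈ openCyl g r := ⟨innerCyl_zero (g := g) ▸ hpC, hmem.2⟩
  rcases h1.eq_or_lt with h1 | h1
  · left
    intro η hη
    filter_upwards [hlsc p hpO η hη] with q hq _ hqt
    linarith [hq hqt, hwM p hpC h1.ge]
  · refine Or.inr ⟨⟨hpO, h1⟩, hwS p hmem.1, ?_⟩
    by_contra! hn
    have := hgK.abs_hGamma_sub_le hK hh (p := p) (q := (x₀, t₀)) ht hx
    dsimp only at this
    linarith [abs_le.mp hn, abs_le.mp this]

lemma le_of_half_height (hK : 0 < K) (hlam : 0 < lam) (hlamLam : lam ≤ Lam)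
    (hθ : PropagatesWith m lam Lam (1 / (16 * (K + 1))) θ)
    (hA : IsElliptic lam Lam A) (hg : Continuous fun q : Spc' m × ℝ => g q.1 q.2)
    (hgK : HolderSemi 1 (1 / 2) K g) (hw : SolvesL A w (CylB g r)) (hM : 0 < M)
    (hh : 0 < h) (hhr : 5 * h ≤ r) (hwM : ∀ p ∈ CylB g r, h ≤ hGamma g p → M ≤ w p)
    (hw1 : ∀ p ∈ CylB g r, -1 ≤ w p) {p : Spc m × ℝ}
    (hp : p ∈ innerCyl g r h (h ^ 2)) (hp1 : h / 2 ≤ hGamma g p) (hp2 : hGamma g p < h) :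
    (M + 1) * θ - 1 ≤ w p := by
  obtain ⟨x₀, t₀⟩ := p
  have hε : 0 < 1 / (16 * (K + 1)) := by positivity
  have hε1 : 1 / (16 * (K + 1)) ≤ 1 := by rw [div_le_one (by positivity)]; linarith
  have hsub : openCyl g r ⊆ CylB g r := fun p hp => innerCyl_zero (g := g) ▸ hp.1
  have hlsc := SolvesL.forwardLSC hA hlam hlamLam (isOpen_openCyl hg)
    (fun p hp => hw p (hsub hp)) (fun p hp => hw1 p (hsub hp))
  have hp₀C : (x₀, t₀) ∈ CylB g r := by
    rw [← innerCyl_zero]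
    exact ⟨fun i => (hp.1 i).trans_le (by linarith), by linarith [hp.2.1, sq_nonneg h], hp.2.2⟩
  have key := hθ A hA w (openCyl g r) (isOpen_openCyl hg) (fun p hp => hw p (hsub hp)) hlsc
    h x₀ t₀ (3 / 2 * h) 1 (M + 1) hh rfl (by linarith) (hw _ hp₀C).2.continuousAt
    (eventually_mem_openCyl hg hp₀C) ?_
  · exact key
  intro p _ hpt ht hx hxn
  have hG := hgK.abs_hGamma_sub_le hK hh (p := p) (q := (x₀, t₀)) ht hx
  dsimp only at hG
  rw [abs_le] at hG hxn
  have hp' : (x₀, t₀) ∈ innerCyl g r (0 + h) (0 + h ^ 2) := by simpa only [zero_add] using hp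
  have h0 : 0 < hGamma g p := by linarith
  have hr : hGamma g p < r := by linarith
  have hpO : p ∈ openCyl g r := mem_innerCyl_of_near hε hε1 hh hp' hpt ht hx h0 hr
  rcases lt_or_ge (h / 4) |xlast p.1 - xlast x₀ - 3 / 2 * h| with h1 | h1
  · exact Or.inr ⟨hpO, hw1 p (hsub hpO), h1⟩
  · left
    rw [abs_le] at h1
    intro η hη
    filter_upwards [hlsc p hpO η hη] with q hq _ hqt
    linarith [hq hqt, hwM p (hsub hpO) (by linarith)]

end Iteration

/-- **Key iterative lemma in Lipschitz-in-space domains** (Lemma 2.5). -/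
theorem key_iterative_lemma (m : ℕ) (hm : 1 ≤ m) (lam Lam K : ℝ)
    (hlam : 0 < lam) (hlamLam : lam ≤ Lam) (hK : 0 < K) :
    ∃ M δ a : ℝ, 0 < M ∧ 0 < δ ∧ δ < 1 ∧ 0 < a ∧
      ∀ (A : Spc m → Matrix (Fin (m + 1)) (Fin (m + 1)) ℝ), IsElliptic lam Lam A →
      ∀ g : Spc' m → ℝ → ℝ,
        Continuous (fun q : Spc' m × ℝ => g q.1 q.2) → g 0 0 = 0 →
        HolderSemi 1 (1 / 2) K g →
      ∀ r : ℝ, 0 < r → r ≤ 1 →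
      ∀ w : Spc m × ℝ → ℝ,
        SolvesL A w (CylB g r) →
        VanishesOn (fun q => max (-w q) 0) (CylB g r) (graphSet g) →
        (∀ p ∈ ASet g δ r, M ≤ w p) →
        (∀ p ∈ CylB g r, -1 ≤ w p) →
        (∀ p ∈ ASet g δ (r / 2), M * a ≤ w p) ∧
        (∀ p ∈ CylB g (r / 2), -a ≤ w p) := by
  obtain ⟨θ, hθ0, hθ1, hθ⟩ := exists_propagatesWith m (ε := 1 / (16 * (K + 1))) hlam hlamLam
    (by positivity) (by rw [div_le_one (by positivity)]; linarith)
  obtain ⟨n, hn⟩ := exists_pow_lt_of_lt_one (half_pos hθ0) (by linarith : 1 - θ < 1)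
  set k := n + 3 with hk
  have hk3 : (3 : ℝ) ≤ k := by rw [hk]; push_cast; linarith [(Nat.cast_nonneg n : (0 : ℝ) ≤ n)]
  have hkθ : (1 - θ) ^ k ≤ θ / 2 :=
    (pow_le_pow_of_le_one (by linarith) (by linarith) (by omega)).trans hn.le
  have hk0 : (0 : ℝ) < k := by linarith
  refine ⟨2 / θ, 1 / (2 * k), θ / 2, by positivity, by positivity,
    by rw [div_lt_one (by positivity)]; linarith, by positivity, ?_⟩
  intro A hA g hg _ hgK r hr _ w hw hvan hwA hw1
  set h := 1 / (2 * k) * r with hh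
  have hh0 : 0 < h := by positivity
  have hkh : k * h = r / 2 := by rw [hh]; field_simp
  have h3 : 3 * h ≤ k * h := by gcongr
  have hkh2 : k * h ^ 2 ≤ r ^ 2 / 12 := by nlinarith
  have hM : 2 / θ * (θ / 2) = 1 := by field_simp
  have hM1 : 1 ≤ 2 / θ := by rw [le_div_iff₀ hθ0]; linarith
  have hwM : ∀ p ∈ CylB g r, h ≤ hGamma g p → 2 / θ ≤ w p := fun p hp hph =>
    hwA p ⟨hp, by unfold hGamma at hph; linarith⟩
  have hdecay : ∀ j : ℕ, ∀ p ∈ innerCyl g r (j * h) (j * h ^ 2), -(1 - θ) ^ j ≤ w p := by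
    intro j
    induction j with
    | zero => simpa [innerCyl_zero] using hw1
    | succ j ih =>
      have := one_sub_mul_le_of_near_graph hK hlam hlamLam hθ hθ1 hA hg hgK hw hvan
        (by positivity) hh0 (by linarith) hwM hw1 (pow_pos (by linarith : 0 < 1 - θ) j)
        (by positivity) (by positivity) ih
      simpa only [Nat.cast_succ, add_one_mul, pow_succ'] using this
  have hhalf : ∀ p ∈ CylB g (r / 2), ∀ s τ, s ≤ k * h → τ ≤ k * h ^ 2 →
      p ∈ innerCyl g r s τ := by
    intro p hp s τ hs hτ
    rw [← innerCyl_zero] at hp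
    obtain ⟨h1, h2, h3, h4, h5⟩ := hp
    exact ⟨fun i => (h1 i).trans_le (by linarith), by nlinarith, h3, h4, by linarith⟩
  refine ⟨fun p hp => ?_, fun p hp => ?_⟩
  · rw [hM]
    have hp1 := hhalf p hp.1 h (h ^ 2) (by linarith) (by nlinarith)
    have hp2 : h / 2 ≤ hGamma g p := by
      have := hp.2
      unfold hGamma
      linarith
    rcases le_or_gt h (hGamma g p) with h4 | h4
    · exact hM1.trans (hwM p (innerCyl_zero (g := g) ▸ hhalf p hp.1 0 0 (by positivity)
        (by positivity)) h4)
    · have := le_of_half_height hK hlam hlamLam hθ hA hg hgK hw (by positivity) hh0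
        (by linarith) hwM hw1 hp1 hp2 h4
      have h5 : (2 / θ + 1) * θ - 1 = 1 + θ := by field_simp; ring
      linarith
  · linarith [hdecay k p (hhalf p hp _ _ le_rfl le_rfl)]
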